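/- Let f₂ = yz − x² and f₃ = 40y³ + 21xyz − 21x³ in ℂ[x,y,z], and let C = V(f₂³ + f₃²) ⊆ ℙ² (a maximal tame torus sextic with one singular point of type C_{3,15}). Then π₁(ℙ² \ C) ≅ ℤ₂ * ℤ₃. -/

import Mathlib

open MvPolynomial

noncomputable section

/-- The complex projective plane, as the projectivization of `ℂ³`. -/
abbrev P2 : Type := Projectivization ℂ (Fin 3 → ℂ)

/-- The complex projective line, as the projectivization of `ℂ²`. -/
abbrev P1 : Type := Projectivization ℂ (Fin 2 → ℂ)

instance : TopologicalSpace P2 :=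
  inferInstanceAs (TopologicalSpace (Quotient (projectivizationSetoid ℂ (Fin 3 → ℂ))))

instance : TopologicalSpace P1 :=
  inferInstanceAs (TopologicalSpace (Quotient (projectivizationSetoid ℂ (Fin 2 → ℂ))))

/-- The zero locus in `ℙ²` of a homogeneous polynomial `g ∈ ℂ[x,y,z]`
(for homogeneous `g` the vanishing of `g` at the chosen representative `x.rep`
is independent of the choice of representative). -/
def V (g : MvPolynomial (Fin 3) ℂ) : Set P2 :=
  {x | eval x.rep g = 0}

/-- The point `[a:b] ∈ ℙ¹`. -/
def pt (a b : ℂ) (hab : ![a, b] ≠ 0) : P1 := Projectivization.mk ℂ ![a, b] hab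

namespace C315
open unitInterval

section abstract_topology
variable {X : Type} [TopologicalSpace X] {p : X}

/-- Homotopy classes of paths starting at `p` (the underlying set of the universal cover). -/
structure UT (p : X) : Type where
  fst : X
  snd : Path.Homotopic.Quotient p fst

/-- Prolong a class of paths by a path. -/
noncomputable def UT.step (t : UT p) (γ : C(I, X)) (h : γ 0 = t.1) : UT p :=
  ⟨γ 1, t.2.trans (.mk ⟨γ, h, rfl⟩)⟩

/-- Precompose with a loop. -/
noncomputable def UT.act (g : Path.Homotopic.Quotient p p) (t : UT p) : UT p := ⟨t.1, g.trans t.2⟩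

/-- The base point. -/
noncomputable def UT.base (p : X) : UT p := ⟨p, .refl p⟩

@[simp] lemma UT.act_fst (g : Path.Homotopic.Quotient p p) (t : UT p) : (t.act g).1 = t.1 := rfl
@[simp] lemma UT.step_fst (t : UT p) (γ : C(I, X)) (h : γ 0 = t.1) : (t.step γ h).1 = γ 1 := rfl

lemma UT.act_act (g h : Path.Homotopic.Quotient p p) (t : UT p) :
    (t.act h).act g = t.act (g.trans h) := by
  simp [UT.act, Path.Homotopic.Quotient.trans_assoc]

lemma UT.act_refl (t : UT p) : t.act (.refl p) = t := by
  simp [UT.act]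

lemma UT.act_base (g : Path.Homotopic.Quotient p p) : (UT.base p).act g = ⟨p, g⟩ := by
  simp [UT.act, UT.base]

lemma UT.act_step (g : Path.Homotopic.Quotient p p) (t : UT p) (γ : C(I, X)) (h : γ 0 = t.1) :
    (t.step γ h).act g = (t.act g).step γ h := by
  simp [UT.act, UT.step, Path.Homotopic.Quotient.trans_assoc]

lemma UT.act_inj {g h : Path.Homotopic.Quotient p p} {t : UT p} (e : t.act g = t.act h) :
    g = h := by
  have e2 : g.trans t.2 = h.trans t.2 := by
    simpa [UT.act] using e
  have := congrArg (fun c => c.trans t.2.symm) e2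
  simpa [Path.Homotopic.Quotient.trans_assoc] using this

lemma UT.exists_act {t t' : UT p} (h : t.1 = t'.1) :
    ∃ g : Path.Homotopic.Quotient p p, t' = t.act g := by
  obtain ⟨x, c⟩ := t
  obtain ⟨y, c'⟩ := t'
  obtain rfl : x = y := h
  exact ⟨c'.trans c.symm, by simp [UT.act, Path.Homotopic.Quotient.trans_assoc]⟩

/-- A map to `UT p` that is compatible with continuation along paths. -/
structure IsFlat {Z : Type} [TopologicalSpace Z] (f : Z → X) (ε : Z → UT p) : Prop where
  proj : ∀ z, (ε z).1 = f z
  step : ∀ (δ : C(I, Z)) (γ : C(I, X)), (∀ s, γ s = f (δ s)) → ∀ (h : γ 0 = (ε (δ 0)).1),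
    ε (δ 1) = (ε (δ 0)).step γ h

variable {Z Z' : Type} [TopologicalSpace Z] [TopologicalSpace Z']

lemma exists_flat [SimplyConnectedSpace Z] (f : C(Z, X)) (t : UT p) (z0 : Z) (h : t.1 = f z0) :
    ∃ ε : Z → UT p, IsFlat f ε ∧ ε z0 = t := by
  obtain ⟨x, e⟩ := t
  obtain rfl : x = f z0 := h
  refine ⟨fun z => ⟨f z, e.trans ((Path.Homotopic.Quotient.mk
    (PathConnectedSpace.somePath z0 z)).map f)⟩, ⟨fun z => rfl, ?_⟩, ?_⟩
  · intro δ γ hγ h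
    have e1 : γ = f.comp δ := by ext s; exact hγ s
    subst e1
    unfold UT.step
    simp only [Path.Homotopic.Quotient.trans_assoc]
    have e2 : (Path.Homotopic.Quotient.mk (⟨f.comp δ, rfl, rfl⟩ : Path (f (δ 0)) (f (δ 1))))
      = (Path.Homotopic.Quotient.mk (⟨δ, rfl, rfl⟩ : Path (δ 0) (δ 1))).map f := rfl
    change (⟨f (δ 1), _⟩ : UT p) = ⟨f (δ 1), _⟩
    congr 2
    change _ = Path.Homotopic.Quotient.trans _ (Path.Homotopic.Quotient.mk
      (⟨f.comp δ, rfl, rfl⟩ : Path (f (δ 0)) (f (δ 1))))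
    rw [e2, ← Path.Homotopic.Quotient.mk_map, ← Path.Homotopic.Quotient.mk_map,
      ← Path.Homotopic.Quotient.mk_map, ← Path.Homotopic.Quotient.mk_trans, ← Path.map_trans,
      Path.Homotopic.Quotient.eq]
    exact (SimplyConnectedSpace.paths_homotopic _ _).map f
  · change (⟨f z0, _⟩ : UT p) = ⟨f z0, _⟩
    congr 1
    have : Path.Homotopic.Quotient.mk (PathConnectedSpace.somePath z0 z0)
        = Path.Homotopic.Quotient.refl z0 := by
      rw [← Path.Homotopic.Quotient.mk_refl, Path.Homotopic.Quotient.eq]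
      exact SimplyConnectedSpace.paths_homotopic _ _
    rw [this, ← Path.Homotopic.Quotient.mk_refl, ← Path.Homotopic.Quotient.mk_map]
    exact Path.Homotopic.Quotient.trans_refl _

lemma IsFlat.comp {f : Z → X} {ε : Z → UT p} (h : IsFlat f ε) (k : C(Z', Z)) :
    IsFlat (fun z => f (k z)) (fun z => ε (k z)) :=
  ⟨fun _ => h.proj _, fun δ γ hγ h0 => h.step (k.comp δ) γ hγ h0⟩

lemma IsFlat.act {f : Z → X} {ε : Z → UT p} (h : IsFlat f ε) (g : Path.Homotopic.Quotient p p) :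
    IsFlat f (fun z => (ε z).act g) :=
  ⟨fun _ => h.proj _, fun δ γ hγ h0 => by
    rw [h.step δ γ hγ (by simpa using h0)]; exact UT.act_step _ _ _ _⟩

lemma IsFlat.congr {f f' : Z → X} {ε : Z → UT p} (h : IsFlat f ε) (e : ∀ z, f z = f' z) :
    IsFlat f' ε := by
  have : f = f' := funext e
  exact this ▸ h

lemma IsFlat.unique [PathConnectedSpace Z] {f : Z → X} (hf : Continuous f) {ε ε' : Z → UT p}
    (h : IsFlat f ε) (h' : IsFlat f ε') (z0 : Z) (e : ε z0 = ε' z0) (z : Z) : ε z = ε' z := by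
  let q := PathConnectedSpace.somePath z0 z
  have h1 := h.step q.toContinuousMap ⟨fun s => f (q s), by fun_prop⟩ (fun s => rfl) (by
    rw [h.proj]; rfl)
  have h2 := h'.step q.toContinuousMap ⟨fun s => f (q s), by fun_prop⟩ (fun s => rfl) (by
    rw [h'.proj]; rfl)
  have e1 : q.toContinuousMap 1 = z := q.target
  have e0 : q.toContinuousMap 0 = z0 := q.source
  rw [e1] at h1 h2
  rw [h1, h2]
  congr 1
  rw [e0, e]

/-- Deck transformations act through loops. -/
lemma IsFlat.deck [PathConnectedSpace Z] {f : Z → X} (hf : Continuous f) {ε : Z → UT p}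
    (h : IsFlat f ε) (T : C(Z, Z)) (hT : ∀ z, f (T z) = f z) (g : Path.Homotopic.Quotient p p)
    (z0 : Z) (e : ε (T z0) = (ε z0).act g) (z : Z) : ε (T z) = (ε z).act g :=
  ((h.comp T).congr hT).unique hf (h.act g) z0 e z

/-- Continuation along an arbitrary path from local continuation. -/
lemma good_step (Good : UT p → Prop)
    (t : UT p) (ht : Good t) (γ : C(I, X)) (h : γ 0 = t.1)
    (hloc : ∀ s : I, ∃ O : Set X, IsOpen O ∧ γ s ∈ O ∧ ∀ t, Good t → ∀ (γ : C(I, X))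
      (h : γ 0 = t.1), (∀ s, γ s ∈ O) → Good (t.step γ h)) : Good (t.step γ h) := by
  have : ContractibleSpace I := (convex_Icc (0:ℝ) 1).contractibleSpace ⟨0, by simp⟩
  choose O hO hxO hgood using hloc
  obtain ⟨ε, hε, hε0⟩ := exists_flat γ t 0 h.symm
  obtain ⟨τ, h0, hmono, ⟨n, hn⟩, hτ⟩ :=
    exists_monotone_Icc_subset_open_cover_unitInterval (c := fun x => γ ⁻¹' (O x))
      (fun x => (hO x).preimage γ.continuous)
      (fun s _ => Set.mem_iUnion.2 ⟨s, hxO _⟩)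
  have key : ∀ k, Good (ε (τ k)) := by
    intro k
    induction k with
    | zero => rw [h0, hε0]; exact ht
    | succ k ih =>
      obtain ⟨x, hx⟩ := hτ k
      have hle : (τ k : ℝ) ≤ τ (k + 1) := hmono (Nat.le_succ k)
      let δ : C(I, I) := ⟨fun s => ⟨(1 - (s : ℝ)) * τ k + s * τ (k + 1), by
        have := s.2.1; have := s.2.2; have := (τ k).2.1; have := (τ (k+1)).2.2
        constructor <;> nlinarith⟩, by fun_prop⟩
      have d0 : δ 0 = τ k := by ext; simp [δ]
      have d1 : δ 1 = τ (k + 1) := by ext; simp [δ]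
      have := hε.step δ (γ.comp δ) (fun s => rfl) (by rw [hε.proj]; rfl)
      rw [← d1, this]
      apply hgood x _ (by rw [d0]; exact ih)
      intro s
      apply hx
      have hs0 := s.2.1
      have hs1 := s.2.2
      constructor
      · change (τ k : ℝ) ≤ (1 - (s : ℝ)) * τ k + s * τ (k + 1)
        nlinarith
      · change (1 - (s : ℝ)) * τ k + s * τ (k + 1) ≤ (τ (k + 1) : ℝ)
        nlinarith
  have h1 := key n
  rw [hn n le_rfl] at h1
  have e2 := hε.step (ContinuousMap.id I) γ (fun s => rfl) (by
    rw [hε.proj]; rfl)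
  have e3 : ε 1 = t.step γ h := by
    refine Eq.trans e2 ?_
    congr 1
  rwa [← e3]

lemma UT.eq_step (g : Path.Homotopic.Quotient p p) :
    ∃ (γ : C(I, X)) (h : γ 0 = (UT.base p).1), (UT.base p).act g = (UT.base p).step γ h := by
  obtain ⟨γ, rfl⟩ := Path.Homotopic.Quotient.mk_surjective g
  refine ⟨γ.toContinuousMap, γ.source, ?_⟩
  have h1 : γ.toContinuousMap 1 = p := γ.target
  unfold UT.act UT.step UT.base
  have : ∀ (x : X) (hx : γ 1 = x), (⟨x, (Path.Homotopic.Quotient.refl p).trans (.mk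
    ⟨γ.toContinuousMap, γ.source, hx⟩)⟩ : UT p) =
      ⟨γ 1, (Path.Homotopic.Quotient.refl p).trans (.mk ⟨γ.toContinuousMap, γ.source, rfl⟩)⟩ := by
    rintro x rfl; rfl
  refine Eq.trans ?_ (this p γ.target)
  simp

end abstract_topology
end C315

namespace C315
open unitInterval

section pieces
variable {X : Type} [TopologicalSpace X] {p : X}

/-- Two classes of paths differ by a loop in `Γ`. -/
def Rel (Γ : Subgroup (FundamentalGroup X p)) (t t' : UT p) : Prop :=
  ∃ g : FundamentalGroup X p, g ∈ Γ ∧ t' = t.act g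

variable {Γ : Subgroup (FundamentalGroup X p)}

lemma Rel.refl (t : UT p) : Rel Γ t t := ⟨1, Γ.one_mem, (UT.act_refl t).symm⟩

lemma Rel.trans {t t' t'' : UT p} (h : Rel Γ t t') (h' : Rel Γ t' t'') : Rel Γ t t'' := by
  obtain ⟨g, hg, rfl⟩ := h
  obtain ⟨g', hg', rfl⟩ := h'
  exact ⟨g * g', Γ.mul_mem hg hg', UT.act_act _ _ _⟩

lemma Rel.symm {t t' : UT p} (h : Rel Γ t t') : Rel Γ t' t := by
  obtain ⟨g, hg, rfl⟩ := h
  refine ⟨g⁻¹, Γ.inv_mem hg, ?_⟩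
  rw [UT.act_act]
  have : (g * g⁻¹ : FundamentalGroup X p) = 1 := mul_inv_cancel g
  exact (Eq.trans (congrArg (fun c : FundamentalGroup X p => t.act c) this) (UT.act_refl t)).symm

lemma Rel.of_act {t t' : UT p} {g : FundamentalGroup X p} (hg : g ∈ Γ) (h : t' = t.act g) :
    Rel Γ t t' := ⟨g, hg, h⟩

lemma Rel.step {t t' : UT p} (h : Rel Γ t t') (γ : C(I, X)) (h0 : γ 0 = t.1) (h0' : γ 0 = t'.1) :
    Rel Γ (t.step γ h0) (t'.step γ h0') := by
  obtain ⟨g, hg, rfl⟩ := h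
  exact ⟨g, hg, (UT.act_step _ _ _ _).symm⟩

lemma Rel.fst {t t' : UT p} (h : Rel Γ t t') : t'.1 = t.1 := by
  obtain ⟨g, hg, rfl⟩ := h; rfl

variable {Z Z' : Type} [TopologicalSpace Z] [TopologicalSpace Z']

/-- `f` has a local section near `x`. -/
def LocSec (f : Z → X) (x : X) : Prop :=
  ∃ (O : Set X) (sg : O → Z), IsOpen O ∧ x ∈ O ∧ Continuous sg ∧ ∀ y : O, f (sg y) = y

lemma sec_step {f : Z → X} {ε : Z → UT p} (hε : IsFlat f ε) {O : Set X} {sg : O → Z}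
    (hsc : Continuous sg) (hs : ∀ y : O, f (sg y) = y) (t : UT p) (γ : C(I, X))
    (h : γ 0 = t.1) (hγ : ∀ s, γ s ∈ O) (ht : Rel Γ (ε (sg ⟨γ 0, hγ 0⟩)) t) :
    Rel Γ (ε (sg ⟨γ 1, hγ 1⟩)) (t.step γ h) := by
  have hc : Continuous (fun s => sg ⟨γ s, hγ s⟩) :=
    hsc.comp (Continuous.subtype_mk γ.continuous hγ)
  have := hε.step ⟨fun s => sg ⟨γ s, hγ s⟩, hc⟩ γ (fun s => (hs ⟨_, hγ s⟩).symm)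
    (by rw [hε.proj]; exact (hs ⟨_, hγ 0⟩).symm)
  simp only [ContinuousMap.coe_mk] at this
  rw [this]
  exact ht.step _ _ _

/-- Transfer along a path connected piece mapping into the range of another piece. -/
lemma transfer [PathConnectedSpace Z'] {f : Z → X} {ε : Z → UT p} (hε : IsFlat f ε)
    (hcompat : ∀ z z', f z = f z' → Rel Γ (ε z) (ε z'))
    {f' : Z' → X} (hf' : Continuous f') {ε' : Z' → UT p} (hε' : IsFlat f' ε')
    (hsec : ∀ z', LocSec f (f' z')) (z0 : Z) (z0' : Z') (h0 : Rel Γ (ε z0) (ε' z0'))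
    (z' : Z') (z : Z) (hz : f z = f' z') : Rel Γ (ε z) (ε' z') := by
  suffices h : ∃ w, Rel Γ (ε w) (ε' z') by
    obtain ⟨w, hw⟩ := h
    refine (hcompat z w ?_).trans hw
    have := hw.fst
    rw [hε'.proj, hε.proj] at this
    rw [hz, this]
  let q := PathConnectedSpace.somePath z0' z'
  let γ : C(I, X) := ⟨fun s => f' (q s), by fun_prop⟩
  have h1 := hε'.step q.toContinuousMap γ (fun s => rfl) (by rw [hε'.proj]; rfl)
  have e1 : q.toContinuousMap 1 = z' := q.target
  have e0 : q.toContinuousMap 0 = z0' := q.source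
  rw [e1] at h1
  rw [h1]
  refine good_step (fun t => ∃ w, Rel Γ (ε w) t) _ ⟨z0, by rw [e0]; exact h0⟩ γ _ ?_
  intro s
  obtain ⟨O, sg, hO, hx, hsc, hs⟩ := hsec (q s)
  refine ⟨O, hO, hx, ?_⟩
  rintro t ⟨w, hw⟩ δ hδ hδO
  refine ⟨_, sec_step hε hsc hs t δ hδ hδO ((hcompat _ _ ?_).trans hw)⟩
  rw [hs ⟨_, hδO 0⟩]
  change δ 0 = f w
  rw [hδ, hw.fst, hε.proj]

/-- Generation of the fundamental group. -/
lemma generation (Good : UT p → Prop) (hbase : Good (UT.base p))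
    (hfin : ∀ t : UT p, t.1 = p → Good t → Rel Γ (UT.base p) t)
    (hloc : ∀ x : X, ∃ (Z : Type) (_ : TopologicalSpace Z) (f : Z → X) (ε : Z → UT p),
      IsFlat f ε ∧ LocSec f x ∧ (∀ t, Good t → ∀ z, f z = t.1 → Rel Γ (ε z) t) ∧
      (∀ z t, Rel Γ (ε z) t → Good t)) (g : FundamentalGroup X p) : g ∈ Γ := by
  obtain ⟨γ, h, e⟩ := UT.eq_step (p := p) g
  have : Good ((UT.base p).act g) := by
    rw [e]
    refine good_step Good _ hbase γ h ?_
    intro s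
    obtain ⟨Z, _, f, ε, hε, ⟨O, sg, hO, hx, hsc, hs⟩, hA, hB⟩ := hloc (γ s)
    refine ⟨O, hO, hx, ?_⟩
    intro t ht δ hδ hδO
    exact hB _ _ (sec_step hε hsc hs t δ hδ hδO (hA t ht _ ((hs ⟨_, hδO 0⟩).trans hδ)))
  obtain ⟨g', hg', e'⟩ := hfin _ rfl this
  rw [UT.act_inj e']
  exact hg'

/-- Monodromy of a flat lift. -/
lemma monodromy_flat {E : Type} [TopologicalSpace E] {π : E → X} (cov : IsCoveringMap π)
    [PathConnectedSpace Z] {f : Z → X} (hf : Continuous f) {ε : Z → UT p} (hε : IsFlat f ε)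
    (s : Z → E) (hs : Continuous s) (hπ : ∀ z, π (s z) = f z) (z0 z : Z)
    (h0 : ε z0 = UT.base p) (g : Path.Homotopic.Quotient p p) (hz : ε z = (UT.base p).act g)
    (e : π ⁻¹' {p}) (he : s z0 = e.1) : ((cov.monodromy g e).1 : E) = s z := by
  let q := PathConnectedSpace.somePath z0 z
  have h1 := hε.step q.toContinuousMap ⟨fun s => f (q s), by fun_prop⟩ (fun s => rfl) (by
    rw [hε.proj]; rfl)
  have e1 : q.toContinuousMap 1 = z := q.target
  have e0 : q.toContinuousMap 0 = z0 := q.source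
  have fz0 : f z0 = p := by rw [← hε.proj, h0]; rfl
  have fz : f z = p := by rw [← hε.proj, hz]; rfl
  let γ : Path p p := ⟨⟨fun s => f (q s), by fun_prop⟩, by simp [fz0], by simp [fz]⟩
  have hg : g = .mk γ := by
    apply UT.act_inj (t := UT.base p)
    rw [← hz]
    rw [e1] at h1
    rw [h1]
    have aux : ∀ (t : UT p) (ht : t = UT.base p) (δ : C(I, X)) (h : δ 0 = t.1) (hp0 : δ 0 = p)
      (hp : δ 1 = p), t.step δ h = (UT.base p).act (.mk (⟨δ, hp0, hp⟩ : Path p p)) := by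
      rintro t rfl δ h hp0 hp
      have : ∀ (x : X) (hx : δ 1 = x), (UT.base p).step δ h = 
        ⟨x, (Path.Homotopic.Quotient.refl p).trans (.mk ⟨δ, hp0, hx⟩)⟩ := by
        rintro x rfl; rfl
      rw [this p hp, UT.act_base]
      simp
    exact aux _ (by rw [e0, h0]) _ _ _ _
  rw [hg]
  have hl : π e.1 = p := e.2
  have key : (⟨fun t => s (q t), by fun_prop⟩ : C(I, E)) = cov.liftPath γ.toContinuousMap e.1 (by
      rw [hl]; exact γ.source) := by
    rw [cov.eq_liftPath_iff']
    refine ⟨?_, ?_⟩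
    · ext t; exact hπ _
    · simp [he]
  have h2 := congrArg (fun k : C(I, E) => k 1) key
  simp only [ContinuousMap.coe_mk, Path.target] at h2
  rw [h2]
  rfl

end pieces
end C315

namespace C315
open unitInterval

abbrev Vec := Fin 3 → ℂ
def F2 (v : Vec) : ℂ := v 1 * v 2 - v 0 ^ 2
def F3 (v : Vec) : ℂ := 40 * v 1 ^ 3 + 21 * v 0 * F2 v
def DD (v : Vec) : ℂ := F2 v ^ 3 + F3 v ^ 2

lemma F2_smul (c : ℂ) (v : Vec) : F2 (c • v) = c ^ 2 * F2 v := by simp [F2]; ring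
lemma F3_smul (c : ℂ) (v : Vec) : F3 (c • v) = c ^ 3 * F3 v := by simp [F3, F2_smul]; ring
lemma DD_smul (c : ℂ) (v : Vec) : DD (c • v) = c ^ 6 * DD v := by
  simp [DD, F2_smul, F3_smul]; ring

lemma continuous_F2 : Continuous F2 := by unfold F2; fun_prop
lemma continuous_F3 : Continuous F3 := by have := continuous_F2; unfold F3; fun_prop
lemma continuous_DD : Continuous DD := by
  have := continuous_F2; have := continuous_F3; unfold DD; fun_prop

/-- The complement of the sextic. -/
abbrev XX : Type := {x : P2 | DD x.rep ≠ 0}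
/-- The affine cone over `XX`. -/
abbrev YY : Type := {v : Vec // DD v ≠ 0}

lemma ne_zero_of_DD {v : Vec} (h : DD v ≠ 0) : v ≠ 0 := by
  rintro rfl; apply h; simp [DD, F2, F3]

lemma mk_DD {v : Vec} (h : DD v ≠ 0) :
    DD (Projectivization.mk ℂ v (ne_zero_of_DD h)).rep ≠ 0 := by
  obtain ⟨a, ha⟩ := Projectivization.exists_smul_eq_mk_rep ℂ v (ne_zero_of_DD h)
  rw [← ha, Units.smul_def, DD_smul]
  exact mul_ne_zero (pow_ne_zero _ a.ne_zero) h

/-- The projection from the cone. -/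
def QQ (v : YY) : XX := ⟨Projectivization.mk ℂ v.1 (ne_zero_of_DD v.2), mk_DD v.2⟩

/-- The chosen representative. -/
def rp (x : XX) : YY := ⟨x.1.rep, x.2⟩

@[simp] lemma QQ_rp (x : XX) : QQ (rp x) = x := Subtype.ext (Projectivization.mk_rep _)

lemma QQ_eq {v w : YY} : QQ v = QQ w ↔ ∃ c : ℂ, c ≠ 0 ∧ w.1 = c • v.1 := by
  rw [QQ, QQ, Subtype.mk.injEq, eq_comm, Projectivization.mk_eq_mk_iff]
  constructor
  · rintro ⟨a, ha⟩; exact ⟨a, a.ne_zero, ha.symm⟩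
  · rintro ⟨c, hc, h⟩; exact ⟨Units.mk0 c hc, h.symm⟩

lemma rp_QQ (v : YY) : ∃ c : ℂ, c ≠ 0 ∧ (rp (QQ v)).1 = c • v.1 := by
  rw [← QQ_eq, QQ_rp]

lemma continuous_mkP : Continuous (fun v : {v : Vec // v ≠ 0} => (Projectivization.mk ℂ v.1 v.2 : P2)) :=
  continuous_quotient_mk' (s := projectivizationSetoid ℂ (Fin 3 → ℂ))

lemma isOpen_P2 (S : Set P2) :
    IsOpen S ↔ IsOpen {v : {v : Vec // v ≠ 0} | (Projectivization.mk ℂ v.1 v.2 : P2) ∈ S} :=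
  Iff.rfl

lemma continuous_QQ : Continuous QQ := by
  refine Continuous.subtype_mk ?_ _
  exact continuous_mkP.comp (Continuous.subtype_mk continuous_subtype_val fun v => ne_zero_of_DD v.2)

lemma isOpenMap_QQ : IsOpenMap QQ := by
  intro U hU
  have hO : IsOpen (Subtype.val '' U : Set Vec) :=
    (isOpen_ne_fun continuous_DD continuous_const).isOpenMap_subtype_val U hU
  refine ⟨{x | ∃ v : YY, v ∈ U ∧ (QQ v).1 = x}, ?_, ?_⟩
  · rw [isOpen_P2]
    have : {v : {v : Vec // v ≠ 0} | (Projectivization.mk ℂ v.1 v.2 : P2) ∈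
        {x | ∃ v : YY, v ∈ U ∧ (QQ v).1 = x}} =
        ⋃ c : ℂˣ, (fun v : {v : Vec // v ≠ 0} => (c : ℂ) • v.1) ⁻¹' (Subtype.val '' U) := by
      ext w
      simp only [Set.mem_ofPred_eq, Set.mem_iUnion, Set.mem_preimage, Set.mem_image]
      constructor
      · rintro ⟨v, hv, h⟩
        have h' : Projectivization.mk ℂ v.1 (ne_zero_of_DD v.2) = Projectivization.mk ℂ w.1 w.2 := h
        rw [Projectivization.mk_eq_mk_iff] at h'
        obtain ⟨a, ha⟩ := h'
        exact ⟨a, v, hv, ha.symm⟩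
      · rintro ⟨c, v, hv, h⟩
        refine ⟨v, hv, ?_⟩
        change Projectivization.mk ℂ v.1 (ne_zero_of_DD v.2) = Projectivization.mk ℂ w.1 w.2
        rw [Projectivization.mk_eq_mk_iff]
        exact ⟨c, h.symm⟩
    rw [this]
    refine isOpen_iUnion fun c => hO.preimage ?_
    fun_prop
  · ext x
    constructor
    · rintro ⟨v, hv, h⟩; exact ⟨v, hv, Subtype.ext h⟩
    · rintro ⟨v, hv, rfl⟩; exact ⟨v, hv, rfl⟩

lemma isQuot_QQ : IsOpenQuotientMap QQ :=
  ⟨fun x => ⟨rp x, QQ_rp x⟩, continuous_QQ, isOpenMap_QQ⟩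

/-- Continuity at a point of `XX` can be tested on the cone. -/
lemma continuousAt_XX {T : Type*} [TopologicalSpace T] {f : XX → T} (v : YY)
    (h : ContinuousAt (fun w : YY => f (QQ w)) v) : ContinuousAt f (QQ v) := by
  have : Filter.map QQ (nhds v) = nhds (QQ v) :=
    isOpenMap_QQ.map_nhds_eq continuous_QQ.continuousAt
  rw [ContinuousAt, ← this, Filter.tendsto_map'_iff]
  exact h

/-- A homogeneous function of degree 0 is continuous. -/
lemma continuousAt_deg0 {T : Type*} [TopologicalSpace T] {f : Vec → T} 
    (hdeg : ∀ (c : ℂ) (v : Vec), c ≠ 0 → f (c • v) = f v) (x : XX)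
    (h : ContinuousAt f (rp x).1) : ContinuousAt (fun x : XX => f (rp x).1) x := by
  rw [← QQ_rp x]
  apply continuousAt_XX (f := fun x : XX => f (rp x).1) (rp x)
  have : (fun w : YY => f (rp (QQ w)).1) = fun w : YY => f w.1 := by
    ext w
    obtain ⟨c, hc, h⟩ := rp_QQ w
    rw [h, hdeg c _ hc]
  rw [this]
  exact h.comp continuous_subtype_val.continuousAt

/-- A conical open condition is open. -/
lemma isOpen_deg0 {P : Vec → Prop} (hdeg : ∀ (c : ℂ) (v : Vec), c ≠ 0 → P v → P (c • v))
    (h : IsOpen {v : YY | P v.1}) : IsOpen {x : XX | P (rp x).1} := by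
  rw [← isQuot_QQ.isQuotientMap.isOpen_preimage]
  convert h using 1
  ext w
  obtain ⟨c, hc, h⟩ := rp_QQ w
  simp only [Set.mem_preimage, Set.mem_ofPred_eq, h]
  refine ⟨fun hh => ?_, hdeg c _ hc⟩
  have := hdeg c⁻¹ _ (inv_ne_zero hc) hh
  rwa [smul_smul, inv_mul_cancel₀ hc, one_smul] at this

end C315

namespace C315
open unitInterval

/-- affine coordinates `(u, w) = (f₂, f₃)` on `y = 1`, `f₂ ≠ 0`. -/
def vecA (u w : ℂ) : Vec := ![(w - 40) / (21 * u), 1, u + ((w - 40) / (21 * u)) ^ 2]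

lemma F2_vecA (u w : ℂ) : F2 (vecA u w) = u := by simp [F2, vecA]
lemma F3_vecA {u : ℂ} (w : ℂ) (hu : u ≠ 0) : F3 (vecA u w) = w := by
  simp only [F3, F2_vecA]; simp [vecA]; field_simp; ring

/-- The affine domain. -/
abbrev AA : Type := {a : ℂ × ℂ // a.1 ≠ 0 ∧ a.1 ^ 3 + a.2 ^ 2 ≠ 0}

def G0 (a : AA) : XX := QQ ⟨vecA a.1.1 a.1.2, by
  rw [DD, F2_vecA, F3_vecA _ a.2.1]; exact a.2.2⟩

lemma continuous_G0 : Continuous G0 := by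
  refine continuous_QQ.comp (Continuous.subtype_mk ?_ _)
  have h1 : Continuous (fun a : AA => (a.1.2 - 40) / (21 * a.1.1)) := by
    refine Continuous.div (by fun_prop) (by fun_prop) fun a => mul_ne_zero (by norm_num) a.2.1
  unfold vecA
  refine continuous_pi fun i => ?_
  fin_cases i
  · exact h1
  · exact continuous_const
  · exact Continuous.add (by fun_prop) (h1.pow 2)

def uu (x : XX) : ℂ := F2 (rp x).1 / (rp x).1 1 ^ 2
def ww (x : XX) : ℂ := F3 (rp x).1 / (rp x).1 1 ^ 3

/-- The locus `y ≠ 0`. -/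
def Yne : Set XX := {x | (rp x).1 1 ≠ 0}

lemma mem_Yne_QQ (v : YY) : QQ v ∈ Yne ↔ v.1 1 ≠ 0 := by
  obtain ⟨c, hc, h⟩ := rp_QQ v
  change (rp (QQ v)).1 1 ≠ 0 ↔ _
  rw [h]; simp [hc]

lemma isOpen_Yne : IsOpen Yne := by
  refine isOpen_deg0 (P := fun v => v 1 ≠ 0) (fun c v hc hv => by simp [hc, hv]) ?_
  exact isOpen_ne_fun ((continuous_apply (A := fun _ : Fin 3 => ℂ) 1).comp continuous_subtype_val) continuous_const

lemma uu_QQ (v : YY) : uu (QQ v) = F2 v.1 / v.1 1 ^ 2 := by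
  obtain ⟨c, hc, h⟩ := rp_QQ v
  rw [uu, h, F2_smul]; simp only [Pi.smul_apply, smul_eq_mul, mul_pow]
  rw [mul_div_mul_left _ _ (pow_ne_zero _ hc)]

lemma ww_QQ (v : YY) : ww (QQ v) = F3 v.1 / v.1 1 ^ 3 := by
  obtain ⟨c, hc, h⟩ := rp_QQ v
  rw [ww, h, F3_smul]; simp only [Pi.smul_apply, smul_eq_mul, mul_pow]
  rw [mul_div_mul_left _ _ (pow_ne_zero _ hc)]

lemma continuousOn_uu : ContinuousOn uu Yne := by
  intro x hx
  refine ContinuousAt.continuousWithinAt ?_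
  refine continuousAt_deg0 (f := fun v => F2 v / v 1 ^ 2) (fun c v hc => ?_) x ?_
  · rw [F2_smul]; simp only [Pi.smul_apply, smul_eq_mul, mul_pow]
    rw [mul_div_mul_left _ _ (pow_ne_zero _ hc)]
  · exact ContinuousAt.div continuous_F2.continuousAt
      ((continuous_apply (A := fun _ : Fin 3 => ℂ) 1).pow 2).continuousAt (pow_ne_zero _ hx)

lemma continuousOn_ww : ContinuousOn ww Yne := by
  intro x hx
  refine ContinuousAt.continuousWithinAt ?_
  refine continuousAt_deg0 (f := fun v => F3 v / v 1 ^ 3) (fun c v hc => ?_) x ?_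
  · rw [F3_smul]; simp only [Pi.smul_apply, smul_eq_mul, mul_pow]
    rw [mul_div_mul_left _ _ (pow_ne_zero _ hc)]
  · exact ContinuousAt.div continuous_F3.continuousAt
      ((continuous_apply (A := fun _ : Fin 3 => ℂ) 1).pow 3).continuousAt (pow_ne_zero _ hx)

@[simp] lemma uu_G0 (a : AA) : uu (G0 a) = a.1.1 := by
  rw [G0, uu_QQ]; simp only [F2_vecA]; simp [vecA]
@[simp] lemma ww_G0 (a : AA) : ww (G0 a) = a.1.2 := by
  rw [G0, ww_QQ]; simp only [F3_vecA _ a.2.1]; simp [vecA]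
lemma G0_mem (a : AA) : G0 a ∈ Yne := by
  rw [G0, mem_Yne_QQ]; simp [vecA]

lemma AA_of (x : XX) (hx : x ∈ Yne) (hu : uu x ≠ 0) :
    uu x ≠ 0 ∧ uu x ^ 3 + ww x ^ 2 ≠ 0 := by
  have hy : (rp x).1 1 ≠ 0 := hx
  refine ⟨hu, ?_⟩
  have : uu x ^ 3 + ww x ^ 2 = DD (rp x).1 / (rp x).1 1 ^ 6 := by
    rw [uu, ww, DD]; field_simp
  rw [this]
  exact div_ne_zero (rp x).2 (pow_ne_zero _ hy)

lemma G0_of (x : XX) (hx : x ∈ Yne) (hu : uu x ≠ 0) : G0 ⟨(uu x, ww x), AA_of x hx hu⟩ = x := by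
  have hy : (rp x).1 1 ≠ 0 := hx
  conv_rhs => rw [← QQ_rp x]
  rw [G0, QQ_eq]
  refine ⟨(rp x).1 1, hy, ?_⟩
  have h2 : F2 (rp x).1 ≠ 0 := by
    intro h; apply hu; rw [uu, h, zero_div]
  have h1 : (ww x - 40) / (21 * uu x) = (rp x).1 0 / (rp x).1 1 := by
    rw [uu, ww, F3]; field_simp; ring
  simp only [vecA, h1]
  ext i
  fin_cases i
  · simp; field_simp
  · simp
  · simp only [uu, F2, Fin.reduceFinMk, Pi.smul_apply, Matrix.cons_val, smul_eq_mul]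
    field_simp; ring

/-- The basic exponential parametrization. -/
abbrev ZE : Type := {z : ℂ × ℂ // 1 - z.2 ^ 2 ≠ 0}

def aE (z : ZE) : AA := ⟨(-Complex.exp (2 * z.1.1), Complex.exp (3 * z.1.1) * z.1.2), by
  have e : (-Complex.exp (2 * z.1.1)) ^ 3 + (Complex.exp (3 * z.1.1) * z.1.2) ^ 2
    = - (Complex.exp (6 * z.1.1) * (1 - z.1.2 ^ 2)) := by
    rw [neg_pow, mul_pow, ← Complex.exp_nat_mul, ← Complex.exp_nat_mul]
    push_cast
    rw [show (3 : ℂ) * (2 * z.1.1) = 6 * z.1.1 by ring, show (2 : ℂ) * (3 * z.1.1) = 6 * z.1.1 by ring]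
    ring
  refine ⟨neg_ne_zero.2 (Complex.exp_ne_zero _), ?_⟩
  rw [e]
  exact neg_ne_zero.2 (mul_ne_zero (Complex.exp_ne_zero _) z.2)⟩

def fE (z : ZE) : XX := G0 (aE z)

lemma continuous_fE : Continuous fE := by
  refine continuous_G0.comp ?_
  unfold aE
  fun_prop

@[simp] lemma uu_fE (z : ZE) : uu (fE z) = -Complex.exp (2 * z.1.1) := uu_G0 _
@[simp] lemma ww_fE (z : ZE) : ww (fE z) = Complex.exp (3 * z.1.1) * z.1.2 := ww_G0 _
lemma fE_mem (z : ZE) : fE z ∈ Yne := G0_mem _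

lemma fE_eq {z z' : ZE} (h1 : Complex.exp (2 * z.1.1) = Complex.exp (2 * z'.1.1))
    (h2 : Complex.exp (3 * z.1.1) * z.1.2 = Complex.exp (3 * z'.1.1) * z'.1.2) :
    fE z = fE z' := by
  have : aE z = aE z' := by
    apply Subtype.ext
    simp only [aE, h1, h2]
  rw [fE, this, fE]

lemma fE_of (x : XX) (hx : x ∈ Yne) (l v : ℂ) (hl : uu x = -Complex.exp (2 * l))
    (hv : ww x = Complex.exp (3 * l) * v) : ∃ h, fE ⟨(l, v), h⟩ = x := by
  have hu : uu x ≠ 0 := by rw [hl]; exact neg_ne_zero.2 (Complex.exp_ne_zero _)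
  have h : 1 - v ^ 2 ≠ 0 := by
    intro h
    apply (AA_of x hx hu).2
    have e : (-Complex.exp (2 * l)) ^ 3 + (Complex.exp (3 * l) * v) ^ 2
      = - (Complex.exp (6 * l) * (1 - v ^ 2)) := by
      rw [neg_pow, mul_pow, ← Complex.exp_nat_mul, ← Complex.exp_nat_mul]
      push_cast
      rw [show (3 : ℂ) * (2 * l) = 6 * l by ring, show (2 : ℂ) * (3 * l) = 6 * l by ring]
      ring
    rw [hl, hv, e, h]; simp
  refine ⟨h, ?_⟩
  rw [← G0_of x hx hu, fE]
  congr 1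
  apply Subtype.ext
  simp only [aE, hl, hv]

lemma rawsec (z0 : ZE) : ∃ (O : Set XX) (sg : XX → ℂ × ℂ), IsOpen O ∧ fE z0 ∈ O ∧
    ContinuousOn sg O ∧ sg (fE z0) = z0.1 ∧ ∀ y ∈ O, ∃ h, fE ⟨sg y, h⟩ = y := by
  set u0 := -Complex.exp (2 * z0.1.1) with hu0
  have hu0' : u0 ≠ 0 := neg_ne_zero.2 (Complex.exp_ne_zero _)
  have hc : ContinuousOn (fun x => uu x / u0) Yne := continuousOn_uu.div_const _
  have hl : ContinuousOn (fun x => z0.1.1 + Complex.log (uu x / u0) / 2)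
      (Yne ∩ (fun x => uu x / u0) ⁻¹' Complex.slitPlane) := by
    refine ContinuousOn.add continuousOn_const (ContinuousOn.div_const ?_ _)
    exact ContinuousOn.clog (hc.mono Set.inter_subset_left) (fun x hx => hx.2)
  refine ⟨Yne ∩ (fun x => uu x / u0) ⁻¹' Complex.slitPlane,
    fun x => (z0.1.1 + Complex.log (uu x / u0) / 2,
      ww x * Complex.exp (-3 * (z0.1.1 + Complex.log (uu x / u0) / 2))), ?_, ?_, ?_, ?_, ?_⟩
  · exact hc.isOpen_inter_preimage isOpen_Yne Complex.isOpen_slitPlane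
  · refine ⟨fE_mem _, ?_⟩
    simp only [Set.mem_preimage, uu_fE, ← hu0, div_self hu0', Complex.one_mem_slitPlane]
  · refine hl.prodMk ((continuousOn_ww.mono Set.inter_subset_left).mul ?_)
    exact (continuousOn_const.mul hl).cexp
  · simp only [uu_fE, ← hu0, div_self hu0', Complex.log_one, ww_fE, zero_div, add_zero]
    ext
    · rfl
    · simp only
      rw [mul_right_comm, ← Complex.exp_add]; simp
  · rintro y ⟨hy, hs⟩
    refine fE_of y hy _ _ ?_ ?_
    · have hne : uu y / u0 ≠ 0 := Complex.slitPlane_ne_zero hs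
      rw [mul_add, Complex.exp_add, mul_div_cancel₀ _ (two_ne_zero), Complex.exp_log hne,
        ← neg_mul, ← hu0, mul_div_cancel₀ _ hu0']
    · rw [mul_left_comm, ← Complex.exp_add]; simp

end C315

namespace C315
open unitInterval

lemma cosh_eq_cosh {s t : ℂ} (h : Complex.cosh s = Complex.cosh t) :
    ∃ k : ℤ, t = 2 * k * Real.pi * Complex.I + s ∨ t = 2 * k * Real.pi * Complex.I - s := by
  rw [← Complex.cos_mul_I, ← Complex.cos_mul_I, Complex.cos_eq_cos_iff] at h
  obtain ⟨k, h | h⟩ := h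
  · refine ⟨-k, Or.inl ?_⟩
    push_cast
    linear_combination (-Complex.I) * h + (t - s) * Complex.I_sq
  · refine ⟨-k, Or.inr ?_⟩
    push_cast
    linear_combination (-Complex.I) * h + (t + s) * Complex.I_sq

lemma cosh_not_real {s : ℂ} (hs : 0 < s.re) (r : ℝ) (hr : |r| ≤ 1) : Complex.cosh s ≠ r := by
  intro h
  have h1 : Real.cos (Real.arccos r) = r := Real.cos_arccos (abs_le.1 hr).1 (abs_le.1 hr).2
  have h2 : Complex.cosh s = Complex.cosh (Real.arccos r * Complex.I) := by
    rw [h, Complex.cosh_mul_I, ← Complex.ofReal_cos, h1]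
  obtain ⟨k, h3 | h3⟩ := cosh_eq_cosh h2
  · have := congrArg Complex.re h3
    simp at this
    linarith
  · have := congrArg Complex.re h3
    simp at this
    linarith

lemma exists_cosh {v : ℂ} (hv : ∀ r : ℝ, |r| ≤ 1 → v ≠ r) : ∃ s : ℂ, 0 < s.re ∧ Complex.cosh s = v := by
  obtain ⟨θ, rfl⟩ := Complex.cos_surjective v
  have him : θ.im ≠ 0 := by
    intro h
    have : θ = (θ.re : ℂ) := Complex.ext rfl (by simpa using h)
    refine hv (Real.cos θ.re) (Real.abs_cos_le_one _) ?_
    rw [this]; simp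
  rcases lt_or_gt_of_ne him with h | h
  · exact ⟨θ * Complex.I, by simpa using h, Complex.cosh_mul_I _⟩
  · exact ⟨-(θ * Complex.I), by simpa using h, by rw [Complex.cosh_neg, Complex.cosh_mul_I]⟩

def ZV : Set (ℂ × ℂ) := {z | 1 - z.2 ^ 2 ∈ Complex.slitPlane}
def ZU : Set (ℂ × ℂ) := {z | 0 < z.2.re}

lemma isOpen_ZV : IsOpen ZV := Complex.isOpen_slitPlane.preimage (by fun_prop)
lemma isOpen_ZU : IsOpen ZU := isOpen_lt continuous_const (by fun_prop)

instance : ContractibleSpace ZV := by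
  refine StarConvex.contractibleSpace (x := 0) ?_ ⟨0, by simp [ZV]⟩
  intro z hz a b ha hb hab
  have h := Complex.starConvex_one_slitPlane hz (a := 1 - b ^ 2) (b := b ^ 2)
    (by nlinarith) (by positivity) (by ring)
  simp only [ZV, Set.mem_ofPred_eq]
  convert h using 1
  simp
  ring

instance : ContractibleSpace ZU := by
  refine Convex.contractibleSpace ?_ ⟨(0, 1), by simp [ZU]⟩
  intro z hz w hw a b ha hb hab
  simp only [ZU, Set.mem_ofPred_eq] at *
  simp
  rcases eq_or_lt_of_le ha with h | h
  · subst h; simp at hab; subst hab; simpa using hw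
  · nlinarith [mul_pos h hz, mul_nonneg hb hw.le]

lemma one_sub_cosh (s : ℂ) (hs : 0 < s.re) : 1 - Complex.cosh s ^ 2 ≠ 0 := by
  intro h
  have h2 : Complex.cosh s ^ 2 = 1 := by linear_combination -h
  rcases sq_eq_one_iff.1 h2 with h3 | h3
  · exact cosh_not_real hs 1 (by simp) (by simpa using h3)
  · exact cosh_not_real hs (-1) (by simp) (by simpa using h3)

def eV (z : ZV) : ZE := ⟨z.1, Complex.slitPlane_ne_zero z.2⟩
def eU (z : ZU) : ZE := ⟨(z.1.1, Complex.cosh z.1.2), one_sub_cosh _ z.2⟩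
def fV (z : ZV) : XX := fE (eV z)
def fU (z : ZU) : XX := fE (eU z)

lemma continuous_fV : Continuous fV := continuous_fE.comp (by unfold eV; fun_prop)
lemma continuous_fU : Continuous fU := continuous_fE.comp (by unfold eU; fun_prop)

lemma locsec_fV (z : ZV) : LocSec fV (fV z) := by
  obtain ⟨O, sg, hO, hm, hc, h0, hs⟩ := rawsec (eV z)
  refine ⟨O ∩ sg ⁻¹' ZV, fun y => ⟨sg y, y.2.2⟩, hc.isOpen_inter_preimage hO isOpen_ZV,
    ⟨hm, ?_⟩, ?_, ?_⟩
  · change sg (fE (eV z)) ∈ ZV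
    rw [h0]; exact z.2
  · refine Continuous.subtype_mk ?_ _
    exact hc.comp_continuous continuous_subtype_val fun y => y.2.1
  · intro y
    obtain ⟨h, e⟩ := hs y y.2.1
    exact e

lemma locsec_fU (z : ZU) : LocSec fU (fU z) := by
  obtain ⟨O, sg, hO, hm, hc, h0, hs⟩ := rawsec (eU z)
  have hsinh : Complex.sinh z.1.2 ≠ 0 := by
    intro h
    apply one_sub_cosh _ z.2
    rw [Complex.cosh_sq, h]; ring
  have hd := (Complex.hasStrictDerivAt_cosh z.1.2).hasStrictFDerivAt_equiv hsinh
  set e := hd.toOpenPartialHomeomorph Complex.cosh with he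
  have hcoe : ∀ s, e s = Complex.cosh s := fun s => rfl
  have hsrc : z.1.2 ∈ e.source := hd.mem_toOpenPartialHomeomorph_source
  have hop : IsOpen (e.target ∩ e.symm ⁻¹' {s : ℂ | 0 < s.re}) :=
    e.symm.isOpen_inter_preimage (isOpen_lt continuous_const Complex.continuous_re)
  have hop2 := hop.preimage (continuous_snd : Continuous (Prod.snd : ℂ × ℂ → ℂ))
  refine ⟨O ∩ sg ⁻¹' (Prod.snd ⁻¹' (e.target ∩ e.symm ⁻¹' {s : ℂ | 0 < s.re})),
    fun y => ⟨((sg y).1, e.symm (sg y).2), y.2.2.2⟩, hc.isOpen_inter_preimage hO hop2,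
    ⟨hm, ?_⟩, ?_, ?_⟩
  · change (sg (fE (eU z))).2 ∈ (e.target ∩ e.symm ⁻¹' {s : ℂ | 0 < s.re})
    rw [h0]
    have h1 : e z.1.2 ∈ e.target := e.map_source hsrc
    refine ⟨h1, ?_⟩
    change 0 < (e.symm (e z.1.2)).re
    rw [e.left_inv hsrc]
    exact z.2
  · refine Continuous.subtype_mk ?_ _
    have h1 := hc.comp_continuous (continuous_subtype_val (p := (· ∈ O ∩ sg ⁻¹' (Prod.snd ⁻¹' (e.target ∩ e.symm ⁻¹' {s : ℂ | 0 < s.re}))))) fun y => y.2.1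
    refine Continuous.prodMk (continuous_fst.comp h1) ?_
    exact e.symm.continuousOn.comp_continuous (continuous_snd.comp h1) fun y => y.2.2.1
  · intro y
    obtain ⟨h, e'⟩ := hs y y.2.1
    refine Eq.trans ?_ e'
    unfold fU
    congr 1
    apply Subtype.ext
    refine Prod.ext rfl ?_
    exact e.right_inv y.2.2.1

lemma exists_fE (x : XX) (hx : x ∈ Yne) (hu : uu x ≠ 0) : ∃ z : ZE, fE z = x := by
  obtain ⟨h, e⟩ := fE_of x hx (Complex.log (-uu x) / 2)
    (ww x * Complex.exp (-(3 * (Complex.log (-uu x) / 2)))) (by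
      rw [mul_div_cancel₀ _ two_ne_zero, Complex.exp_log (neg_ne_zero.2 hu), neg_neg]) (by
      rw [mul_left_comm, ← Complex.exp_add]; simp)
  exact ⟨_, e⟩

lemma exists_fU (z : ZE) (hz : ∀ r : ℝ, |r| ≤ 1 → z.1.2 ≠ r) : ∃ z', fU z' = fE z := by
  obtain ⟨s, hs, e⟩ := exists_cosh hz
  refine ⟨⟨(z.1.1, s), hs⟩, ?_⟩
  unfold fU
  congr 1
  exact Subtype.ext (Prod.ext rfl e)

lemma exists_UV (z : ZE) : (∃ z', fV z' = fE z) ∨ ∃ z', fU z' = fE z := by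
  by_cases h : 1 - z.1.2 ^ 2 ∈ Complex.slitPlane
  · exact Or.inl ⟨⟨z.1, h⟩, rfl⟩
  · refine Or.inr (exists_fU z ?_)
    rintro r hr e
    have hz := z.2
    rw [e] at h hz
    apply h
    have h1 : (1 : ℂ) - (r : ℂ) ^ 2 = ((1 - r ^ 2 : ℝ) : ℂ) := by push_cast; ring
    rw [h1] at hz ⊢
    have h3 : 1 - r ^ 2 ≠ 0 := by exact_mod_cast hz
    have h2 : 0 ≤ 1 - r ^ 2 := by nlinarith [abs_nonneg r, sq_abs r]
    rw [Complex.ofReal_mem_slitPlane]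
    exact lt_of_le_of_ne h2 h3.symm

lemma exp_fiber {l l' : ℂ} (h : Complex.exp (2 * l) = Complex.exp (2 * l')) :
    ∃ n : ℤ, l' = l + n * (Real.pi * Complex.I) := by
  obtain ⟨n, hn⟩ := Complex.exp_eq_exp_iff_exists_int.1 h
  exact ⟨-n, by push_cast; linear_combination -hn / 2⟩

lemma fE_fiber {z z' : ZE} (h : fE z = fE z') :
    (∃ n : ℤ, z'.1.1 = z.1.1 + n * (Real.pi * Complex.I)) ∧
    Complex.exp (3 * z.1.1) * z.1.2 = Complex.exp (3 * z'.1.1) * z'.1.2 := by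
  have h1 := congrArg uu h
  have h2 := congrArg ww h
  rw [uu_fE, uu_fE, neg_inj] at h1
  rw [ww_fE, ww_fE] at h2
  exact ⟨exp_fiber h1, h2⟩

lemma exp_int_pi (n : ℤ) : Complex.exp (n * (Real.pi * Complex.I)) = (-1) ^ n := by
  rw [Complex.exp_int_mul, Complex.exp_pi_mul_I]

lemma cosh_add_pi (s : ℂ) : Complex.cosh (s + Real.pi * Complex.I) = - Complex.cosh s := by
  rw [Complex.cosh_add, Complex.cosh_mul_I, Complex.sinh_mul_I]; simp

lemma cosh_sub_pi (s : ℂ) : Complex.cosh (s - Real.pi * Complex.I) = - Complex.cosh s := by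
  rw [Complex.cosh_sub, Complex.cosh_mul_I, Complex.sinh_mul_I]; simp

lemma cosh_add_int_pi (s : ℂ) (n : ℤ) :
    Complex.cosh (s + n * (Real.pi * Complex.I)) = (-1) ^ n * Complex.cosh s := by
  have e1 := exp_int_pi n
  have e2 : Complex.exp (-(n * (Real.pi * Complex.I))) = (-1) ^ n := by
    rw [Complex.exp_neg, e1, ← inv_zpow]; norm_num
  rw [Complex.cosh, Complex.cosh, neg_add, Complex.exp_add, Complex.exp_add, e1, e2]
  ring

lemma fU_fiber {z z' : ZU} (h : fU z = fU z') : ∃ a b : ℤ,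
    z'.1.1 = z.1.1 + a * (Real.pi * Complex.I) + b * (2 * Real.pi * Complex.I) ∧
    z'.1.2 = z.1.2 - a * (Real.pi * Complex.I) := by
  obtain ⟨⟨n, hn⟩, h2⟩ := fE_fiber h
  simp only [eU] at hn h2
  have h3 : Complex.cosh (z.1.2 + n * (Real.pi * Complex.I)) = Complex.cosh z'.1.2 := by
    rw [cosh_add_int_pi]
    have h4 : Complex.exp (3 * z'.1.1) = Complex.exp (3 * z.1.1) * (-1) ^ n := by
      rw [hn, mul_add, Complex.exp_add, show (3 : ℂ) * (n * (Real.pi * Complex.I))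
        = ((3 * n : ℤ) : ℂ) * (Real.pi * Complex.I) by push_cast; ring, exp_int_pi, zpow_mul]
      norm_num
    rw [h4, mul_assoc] at h2
    have h5 := mul_left_cancel₀ (Complex.exp_ne_zero _) h2
    rw [h5, ← mul_assoc, ← mul_zpow]; norm_num
  obtain ⟨k, h4 | h4⟩ := cosh_eq_cosh h3
  · refine ⟨-(n + 2 * k), n + k, ?_, ?_⟩
    · rw [hn]; push_cast; ring
    · rw [h4]; push_cast; ring
  · exfalso
    have h5 := congrArg Complex.re h4
    have h6 : 0 < z.1.2.re := z.2
    have h7 : 0 < z'.1.2.re := z'.2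
    simp at h5
    linarith

end C315

namespace C315
open unitInterval

lemma exp_m2 : Real.exp (-2) ≤ 1 / 3 := by
  rw [Real.exp_neg, one_div]
  apply inv_anti₀ (by norm_num)
  have := Real.add_one_le_exp (2 : ℝ)
  linarith

lemma DD_of_big {v : Vec} (h2 : ‖F2 v‖ ≤ 2) (h3 : 3 ≤ ‖F3 v‖) : DD v ≠ 0 := by
  intro h
  have e : F3 v ^ 2 = - F2 v ^ 3 := by rw [DD] at h; linear_combination h
  have e2 := congrArg norm e
  rw [norm_pow, norm_neg, norm_pow] at e2
  have := pow_le_pow_left₀ (norm_nonneg _) h2 3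
  nlinarith

lemma fU_of_big (v : YY) (h2 : ‖F2 v.1‖ ≤ 2) (h3 : 3 ≤ ‖F3 v.1‖) (hy : v.1 1 ≠ 0)
    (hf : F2 v.1 ≠ 0) : ∃ z, fU z = QQ v := by
  have hu : uu (QQ v) ≠ 0 := by
    rw [uu_QQ]; exact div_ne_zero hf (pow_ne_zero _ hy)
  obtain ⟨z, hz⟩ := exists_fE (QQ v) ((mem_Yne_QQ v).2 hy) hu
  rw [← hz]
  apply exists_fU
  rintro r hr e
  have h1 := congrArg uu hz
  have h4 := congrArg ww hz
  rw [uu_fE, uu_QQ] at h1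
  rw [ww_fE, ww_QQ, e] at h4
  have key : F3 v.1 ^ 2 = - F2 v.1 ^ 3 * (r : ℂ) ^ 2 := by
    have a1 : F2 v.1 = - Complex.exp (2 * z.1.1) * v.1 1 ^ 2 := by
      rw [h1, div_mul_cancel₀ _ (pow_ne_zero _ hy)]
    have a2 : F3 v.1 = Complex.exp (3 * z.1.1) * r * v.1 1 ^ 3 := by
      rw [h4, div_mul_cancel₀ _ (pow_ne_zero _ hy)]
    have a3 : Complex.exp (3 * z.1.1) ^ 2 = Complex.exp (2 * z.1.1) ^ 3 := by
      rw [← Complex.exp_nat_mul, ← Complex.exp_nat_mul]; push_cast; ring_nf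
    rw [a1, a2]
    linear_combination (r : ℂ) ^ 2 * v.1 1 ^ 6 * a3
  have e2 := congrArg norm key
  rw [norm_pow, norm_mul, norm_neg, norm_pow, norm_pow, Complex.norm_real, Real.norm_eq_abs] at e2
  have b1 := pow_le_pow_left₀ (norm_nonneg _) h2 3
  have b2 := pow_le_pow_left₀ (abs_nonneg r) hr 2
  have b3 : ‖F2 v.1‖ ^ 3 * |r| ^ 2 ≤ 2 ^ 3 * 1 ^ 2 := by gcongr
  nlinarith

/-- The domain of the charts at the exceptional points. -/
def BB : Set (ℂ × ℂ) := {b | ‖b.1‖ < Real.exp (-2) ∧ ‖b.1 * b.2‖ < 1 / 4}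

lemma isOpen_BB : IsOpen BB := by
  have h1 : IsOpen {b : ℂ × ℂ | ‖b.1‖ < Real.exp (-2)} := isOpen_lt (by fun_prop) continuous_const
  have h2 : IsOpen {b : ℂ × ℂ | ‖b.1 * b.2‖ < 1 / 4} := isOpen_lt (by fun_prop) continuous_const
  exact h1.inter h2

instance : ContractibleSpace BB := by
  refine StarConvex.contractibleSpace (x := 0) ?_ ⟨0, by simp [BB, Real.exp_pos]⟩
  rintro ⟨z1, z2⟩ ⟨h1, h2⟩ a b ha hb hab
  have hb1 : b ≤ 1 := by linarith
  simp only at h1 h2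
  constructor
  · simp only [smul_zero, zero_add, Prod.smul_mk, norm_smul, Real.norm_eq_abs, abs_of_nonneg hb]
    nlinarith [norm_nonneg z1]
  · simp only [smul_zero, zero_add, Prod.smul_mk]
    rw [smul_mul_smul_comm, norm_smul, Real.norm_eq_abs, abs_of_nonneg (by positivity)]
    have h4 : b * b ≤ 1 := by nlinarith
    nlinarith [norm_nonneg (z1 * z2), mul_nonneg hb hb]

def vecN (b : ℂ × ℂ) : Vec := ![1, b.1, b.2]
def vecM (b : ℂ × ℂ) : Vec := ![b.2, 1, b.1 + b.2 ^ 2]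

lemma F2_vecN (b : ℂ × ℂ) : F2 (vecN b) = b.1 * b.2 - 1 := by simp [F2, vecN]
lemma F3_vecN (b : ℂ × ℂ) : F3 (vecN b) = 40 * b.1 ^ 3 + 21 * (b.1 * b.2 - 1) := by
  simp only [F3, F2_vecN]; simp [vecN]
lemma F2_vecM (b : ℂ × ℂ) : F2 (vecM b) = b.1 := by simp [F2, vecM]
lemma F3_vecM (b : ℂ × ℂ) : F3 (vecM b) = 40 + 21 * (b.1 * b.2) := by
  simp only [F3, F2_vecM]; simp [vecM]; ring

lemma bN2 (b : BB) : ‖F2 (vecN b.1)‖ ≤ 2 := by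
  rw [F2_vecN]
  have := norm_sub_le (b.1.1 * b.1.2) 1
  have := b.2.2
  simp at *; linarith
lemma bN2' (b : BB) : F2 (vecN b.1) ≠ 0 := by
  rw [F2_vecN]
  intro h
  have h1 : b.1.1 * b.1.2 = 1 := by linear_combination h
  have := b.2.2
  rw [h1] at this
  norm_num at this
lemma bN3 (b : BB) : 3 ≤ ‖F3 (vecN b.1)‖ := by
  rw [F3_vecN]
  have h1 := b.2.2
  have h2 : ‖b.1.1‖ ≤ 1 / 3 := b.2.1.le.trans exp_m2
  have h3 : (21 : ℂ) = 40 * b.1.1 ^ 3 + 21 * (b.1.1 * b.1.2)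
    - (40 * b.1.1 ^ 3 + 21 * (b.1.1 * b.1.2 - 1)) := by ring
  have h4 := congrArg norm h3
  have h5 := norm_sub_le (40 * b.1.1 ^ 3 + 21 * (b.1.1 * b.1.2))
    (40 * b.1.1 ^ 3 + 21 * (b.1.1 * b.1.2 - 1))
  have h6 := norm_add_le (40 * b.1.1 ^ 3) (21 * (b.1.1 * b.1.2))
  rw [norm_mul, norm_mul 21, norm_pow] at h6
  have h7 := pow_le_pow_left₀ (norm_nonneg _) h2 3
  norm_num at *
  linarith
lemma bM2 (b : BB) : ‖F2 (vecM b.1)‖ ≤ 2 := by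
  rw [F2_vecM]
  have h2 : ‖b.1.1‖ ≤ 1 / 3 := b.2.1.le.trans exp_m2
  linarith
lemma bM3 (b : BB) : 3 ≤ ‖F3 (vecM b.1)‖ := by
  rw [F3_vecM]
  have h1 := b.2.2
  have h5 := norm_sub_le (40 + 21 * (b.1.1 * b.1.2)) (21 * (b.1.1 * b.1.2))
  rw [add_sub_cancel_right, norm_mul 21] at h5
  norm_num at *
  linarith

def yN (b : BB) : YY := ⟨vecN b.1, DD_of_big (bN2 b) (bN3 b)⟩
def yM (b : BB) : YY := ⟨vecM b.1, DD_of_big (bM2 b) (bM3 b)⟩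
def fN (b : BB) : XX := QQ (yN b)
def fM (b : BB) : XX := QQ (yM b)

lemma continuous_fN : Continuous fN := by
  refine continuous_QQ.comp (Continuous.subtype_mk ?_ _)
  unfold vecN
  fun_prop
lemma continuous_fM : Continuous fM := by
  refine continuous_QQ.comp (Continuous.subtype_mk ?_ _)
  unfold vecM
  fun_prop

lemma fN_inj {b b' : BB} (h : fN b = fN b') : b = b' := by
  obtain ⟨c, hc, e⟩ := QQ_eq.1 h
  simp only [yN, vecN] at e
  have e0 := congrFun e 0
  have e1 := congrFun e 1
  have e2 := congrFun e 2
  simp at e0 e1 e2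
  subst e0
  exact Subtype.ext (Prod.ext (by simpa using e1.symm) (by simpa using e2.symm))
lemma fM_inj {b b' : BB} (h : fM b = fM b') : b = b' := by
  obtain ⟨c, hc, e⟩ := QQ_eq.1 h
  simp only [yM, vecM] at e
  have e0 := congrFun e 0
  have e1 := congrFun e 1
  have e2 := congrFun e 2
  simp at e0 e1 e2
  subst e1
  rw [e0] at e2
  exact Subtype.ext (Prod.ext (by simpa using e2.symm) (by simpa using e0.symm))

lemma fN_mem_Yne (b : BB) : fN b ∈ Yne ↔ b.1.1 ≠ 0 := by
  rw [fN, mem_Yne_QQ]; simp [yN, vecN]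
lemma fM_uu (b : BB) : uu (fM b) = b.1.1 := by
  rw [fM, uu_QQ]; simp only [yM, F2_vecM]; simp [vecM]
lemma fN_fU (b : BB) (h : b.1.1 ≠ 0) : ∃ z, fU z = fN b :=
  fU_of_big (yN b) (bN2 b) (bN3 b) (by simpa [yN, vecN] using h) (bN2' b)
lemma fM_fU (b : BB) (h : b.1.1 ≠ 0) : ∃ z, fU z = fM b :=
  fU_of_big (yM b) (bM2 b) (bM3 b) (by simp [yM, vecM]) (by simpa [yM, F2_vecM] using h)

lemma locsec_chart {f : BB → XX} (k : Vec → ℂ × ℂ) (i : Fin 3)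
    (hdeg : ∀ (c : ℂ) (v : Vec), c ≠ 0 → k (c • v) = k v)
    (hk : ∀ v : Vec, v i ≠ 0 → ContinuousAt k v)
    (hf : ∀ (x : XX) (b : BB), (rp x).1 i ≠ 0 → b.1 = k (rp x).1 → f b = x)
    (x : XX) (hx : (rp x).1 i ≠ 0) (hx' : k (rp x).1 ∈ BB) : LocSec f x := by
  have ho : IsOpen {x : XX | (rp x).1 i ≠ 0} := by
    refine isOpen_deg0 (P := fun v => v i ≠ 0) (fun c v hc hv => by simp [hc, hv]) ?_
    exact isOpen_ne_fun ((continuous_apply (A := fun _ : Fin 3 => ℂ) i).comp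
      continuous_subtype_val) continuous_const
  have hc : ContinuousOn (fun x : XX => k (rp x).1) {x : XX | (rp x).1 i ≠ 0} := by
    intro y hy
    exact (continuousAt_deg0 hdeg y (hk _ hy)).continuousWithinAt
  refine ⟨{x : XX | (rp x).1 i ≠ 0} ∩ (fun x : XX => k (rp x).1) ⁻¹' BB,
    fun y => ⟨k (rp y).1, y.2.2⟩, hc.isOpen_inter_preimage ho isOpen_BB, ⟨hx, hx'⟩, ?_, ?_⟩
  · refine Continuous.subtype_mk ?_ _
    exact hc.comp_continuous continuous_subtype_val fun y => y.2.1
  · intro y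
    exact hf _ _ y.2.1 rfl

lemma locsec_fN (x : XX) (hx : x ∉ Yne) : LocSec fN x := by
  have hy : (rp x).1 1 = 0 := by
    by_contra h; exact hx h
  have hx0 : (rp x).1 0 ≠ 0 := by
    intro h
    apply (rp x).2
    simp [DD, F2, F3, h, hy]
  refine locsec_chart (fun v => (v 1 / v 0, v 2 / v 0)) 0 ?_ ?_ ?_ x hx0 ?_
  · intro c v hc
    simp [mul_div_mul_left _ _ hc]
  · intro v hv
    exact ((continuous_apply (A := fun _ : Fin 3 => ℂ) 1).continuousAt.div
      (continuous_apply (A := fun _ : Fin 3 => ℂ) 0).continuousAt hv).prodMk 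
      ((continuous_apply (A := fun _ : Fin 3 => ℂ) 2).continuousAt.div
      (continuous_apply (A := fun _ : Fin 3 => ℂ) 0).continuousAt hv)
  · intro x b h e
    conv_rhs => rw [← QQ_rp x]
    rw [fN, QQ_eq]
    refine ⟨_, h, ?_⟩
    simp only [yN, vecN, e]
    ext i
    fin_cases i
    · simp
    · simp; field_simp
    · simp; field_simp
  · simp [BB, hy, Real.exp_pos]

lemma locsec_fM (x : XX) (hx : x ∈ Yne) (hu : uu x = 0) : LocSec fM x := by
  refine locsec_chart (fun v => (F2 v / v 1 ^ 2, v 0 / v 1)) 1 ?_ ?_ ?_ x hx ?_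
  · intro c v hc
    rw [F2_smul]
    simp [mul_div_mul_left _ _ hc, mul_pow]
    rw [mul_div_mul_left _ _ (pow_ne_zero _ hc)]
  · intro v hv
    exact (continuous_F2.continuousAt.div
      ((continuous_apply (A := fun _ : Fin 3 => ℂ) 1).pow 2).continuousAt (pow_ne_zero _ hv)).prodMk 
      ((continuous_apply (A := fun _ : Fin 3 => ℂ) 0).continuousAt.div
      (continuous_apply (A := fun _ : Fin 3 => ℂ) 1).continuousAt hv)
  · intro x b h e
    conv_rhs => rw [← QQ_rp x]
    rw [fM, QQ_eq]
    refine ⟨_, h, ?_⟩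
    simp only [yM, vecM, e]
    ext i
    fin_cases i
    · simp; field_simp
    · simp
    · simp [F2]; field_simp; ring
  · have : F2 (rp x).1 / (rp x).1 1 ^ 2 = 0 := hu
    simp only [BB, Set.mem_ofPred_eq, this]
    simp [Real.exp_pos]

/-- Convex parametrization of the complement of the divisor in the chart. -/
def KK : Set (ℂ × ℂ) := {a | a.1.re < -2 ∧ ‖a.2‖ < 1 / 4}

instance : ContractibleSpace KK := by
  have h1 : Convex ℝ KK := by
    have h : KK = {z : ℂ | z.re < -2} ×ˢ Metric.ball (0 : ℂ) (1 / 4) := by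
      ext z; simp [KK]
    rw [h]
    exact (convex_halfSpace_re_lt _).prod (convex_ball _ _)
  exact h1.contractibleSpace ⟨(-3, 0), by simp [KK]; norm_num⟩

def kB : C(KK, BB) := ⟨fun a => ⟨(Complex.exp a.1.1, a.1.2 * Complex.exp (-a.1.1)), by
  have h := a.2
  refine ⟨?_, ?_⟩
  · simp only [Complex.norm_exp]
    exact Real.exp_lt_exp.2 h.1
  · simp only
    rw [mul_left_comm, ← Complex.exp_add]; simp
    simpa using h.2⟩, by fun_prop⟩

lemma kB_ne (a : KK) : (kB a).1.1 ≠ 0 := Complex.exp_ne_zero _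

lemma kB_surj (b : BB) (h : b.1.1 ≠ 0) : ∃ a, kB a = b := by
  have hb := b.2
  refine ⟨⟨(Complex.log b.1.1, b.1.1 * b.1.2), ?_, hb.2⟩, ?_⟩
  · simp only [Complex.log_re]
    rw [← Real.log_exp (-2)]
    exact Real.log_lt_log (norm_pos_iff.2 h) hb.1
  · apply Subtype.ext
    simp only [kB, ContinuousMap.coe_mk, Complex.exp_log h, Complex.exp_neg]
    refine Prod.ext rfl ?_
    simp only
    field_simp

end C315

namespace C315
open unitInterval


lemma exp2_add (l : ℂ) : Complex.exp (2 * (l + ((Real.pi : ℂ) * Complex.I))) = Complex.exp (2 * l) := by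
  rw [mul_add, Complex.exp_add, ← mul_assoc, Complex.exp_two_pi_mul_I, mul_one]
lemma exp3_add (l : ℂ) : Complex.exp (3 * (l + ((Real.pi : ℂ) * Complex.I))) = - Complex.exp (3 * l) := by
  rw [show 3 * (l + ((Real.pi : ℂ) * Complex.I)) = 3 * l + 2 * Real.pi * Complex.I + ((Real.pi : ℂ) * Complex.I) by ring, Complex.exp_add,
    Complex.exp_add, Complex.exp_two_pi_mul_I, Complex.exp_pi_mul_I]; ring

def TV : C(ZV, ZV) := ⟨fun z => ⟨(z.1.1 + ((Real.pi : ℂ) * Complex.I), - z.1.2), by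
  have := z.2
  simpa [ZV] using this⟩, by fun_prop⟩
def TB : C(ZU, ZU) := ⟨fun z => ⟨(z.1.1 + ((Real.pi : ℂ) * Complex.I), z.1.2 - ((Real.pi : ℂ) * Complex.I)), by
  have := z.2
  simpa [ZU] using this⟩, by fun_prop⟩
def TC : C(ZU, ZU) := ⟨fun z => ⟨(z.1.1 + ((Real.pi : ℂ) * Complex.I) + ((Real.pi : ℂ) * Complex.I), z.1.2), z.2⟩, by fun_prop⟩

lemma fV_TV (z : ZV) : fV (TV z) = fV z := by
  apply fE_eq
  · exact exp2_add _
  · change Complex.exp (3 * (z.1.1 + ((Real.pi : ℂ) * Complex.I))) * (- z.1.2) = Complex.exp (3 * z.1.1) * z.1.2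
    rw [exp3_add]; ring
lemma fU_TB (z : ZU) : fU (TB z) = fU z := by
  apply fE_eq
  · exact exp2_add _
  · change Complex.exp (3 * (z.1.1 + ((Real.pi : ℂ) * Complex.I))) * Complex.cosh (z.1.2 - ((Real.pi : ℂ) * Complex.I)) =
      Complex.exp (3 * z.1.1) * Complex.cosh z.1.2
    rw [exp3_add, cosh_sub_pi]; ring
lemma fU_TC (z : ZU) : fU (TC z) = fU z := by
  apply fE_eq
  · exact (exp2_add _).trans (exp2_add _)
  · change Complex.exp (3 * (z.1.1 + ((Real.pi : ℂ) * Complex.I) + ((Real.pi : ℂ) * Complex.I))) * Complex.cosh z.1.2 =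
      Complex.exp (3 * z.1.1) * Complex.cosh z.1.2
    rw [exp3_add, exp3_add]; ring

def s0 : ℂ := 1 + (Real.pi / 2 : ℝ) * Complex.I
lemma cosh_s0 : Complex.cosh s0 = (Real.sinh 1 : ℝ) * Complex.I := by
  rw [s0, Complex.cosh_add, Complex.cosh_mul_I, Complex.sinh_mul_I, ← Complex.ofReal_cos,
    ← Complex.ofReal_sin]
  simp
def zU0 : ZU := ⟨(0, s0), by simp [ZU, s0]⟩
def zV0 : ZV := ⟨(0, Complex.cosh s0), by
  have : 1 - Complex.cosh s0 ^ 2 = ((1 + Real.sinh 1 ^ 2 : ℝ) : ℂ) := by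
    rw [cosh_s0, mul_pow, Complex.I_sq]; push_cast; ring
  change 1 - Complex.cosh s0 ^ 2 ∈ Complex.slitPlane
  rw [this, Complex.ofReal_mem_slitPlane]
  positivity⟩
def p0 : XX := fU zU0
lemma p0_V : fV zV0 = p0 := rfl

lemma exists_eV : ∃ ε : ZV → UT p0, IsFlat fV ε ∧ ε zV0 = UT.base p0 :=
  exists_flat ⟨fV, continuous_fV⟩ (UT.base p0) zV0 rfl
lemma exists_eU : ∃ ε : ZU → UT p0, IsFlat fU ε ∧ ε zU0 = UT.base p0 :=
  exists_flat ⟨fU, continuous_fU⟩ (UT.base p0) zU0 rfl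

def epV : ZV → UT p0 := exists_eV.choose
def epU : ZU → UT p0 := exists_eU.choose
lemma epV_flat : IsFlat fV epV := exists_eV.choose_spec.1
lemma epV_0 : epV zV0 = UT.base p0 := exists_eV.choose_spec.2
lemma epU_flat : IsFlat fU epU := exists_eU.choose_spec.1
lemma epU_0 : epU zU0 = UT.base p0 := exists_eU.choose_spec.2

lemma exists_al : ∃ g : Path.Homotopic.Quotient p0 p0, epV (TV zV0) = (epV zV0).act g :=
  UT.exists_act (by rw [epV_flat.proj, epV_flat.proj, fV_TV])
lemma exists_be : ∃ g : Path.Homotopic.Quotient p0 p0, epU (TB zU0) = (epU zU0).act g :=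
  UT.exists_act (by rw [epU_flat.proj, epU_flat.proj, fU_TB])

def al : FundamentalGroup XX p0 := exists_al.choose
def be : FundamentalGroup XX p0 := exists_be.choose

lemma epV_TV (z : ZV) : epV (TV z) = (epV z).act al :=
  epV_flat.deck continuous_fV TV fV_TV _ zV0 exists_al.choose_spec z
lemma epU_TB (z : ZU) : epU (TB z) = (epU z).act be :=
  epU_flat.deck continuous_fU TB fU_TB _ zU0 exists_be.choose_spec z

/-- The curve through the point `y = 0`. -/
def vP (t : ℂ) : Vec := ![-(21 - 40 * t ^ 3), 21 * t, -(40 * t ^ 2 * (42 - 40 * t ^ 3) / 21)]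
lemma F2_vP (t : ℂ) : F2 (vP t) = -441 := by simp [F2, vP]; ring
lemma F3_vP (t : ℂ) : F3 (vP t) = 194481 := by
  simp only [F3, F2_vP]; simp [vP]; ring
def yP (t : ℂ) : YY := ⟨vP t, by rw [DD, F2_vP, F3_vP]; norm_num⟩
def fP : C(ℂ, XX) := ⟨fun t => QQ (yP t), by
  refine continuous_QQ.comp (Continuous.subtype_mk ?_ _)
  unfold vP
  fun_prop⟩

lemma epU_TC (z : ZU) : epU (TC z) = epU z := by
  obtain ⟨s1, hs1, e1⟩ := exists_cosh (v := 21) (by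
    intro r hr h
    have : (21 : ℝ) = r := by exact_mod_cast h
    rw [← this] at hr; norm_num at hr)
  let k : C(ℂ, ZU) := ⟨fun l => ⟨(l, s1), hs1⟩, by fun_prop⟩
  let j : C(ℂ, ℂ) := ⟨fun l => Complex.exp (-l), by fun_prop⟩
  have hjk : ∀ l, fP (j l) = fU (k l) := by
    intro l
    have hne : vP (Complex.exp (-l)) 1 ≠ 0 := by
      simp [vP]
    obtain ⟨h, e⟩ := fE_of (fP (j l)) ((mem_Yne_QQ _).2 hne) l 21 (by
        change uu (QQ (yP (Complex.exp (-l)))) = _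
        rw [uu_QQ]; simp only [yP, F2_vP]; simp [vP]
        rw [show 2 * l = l + l by ring, Complex.exp_add, Complex.exp_neg]
        field_simp; norm_num) (by
        change ww (QQ (yP (Complex.exp (-l)))) = _
        rw [ww_QQ]; simp only [yP, F3_vP]; simp [vP]
        rw [show 3 * l = l + l + l by ring, Complex.exp_add, Complex.exp_add, Complex.exp_neg]
        field_simp; norm_num)
    rw [← e]
    unfold fU
    congr 1
    exact Subtype.ext (Prod.ext rfl e1.symm)
  have hj0 : j 0 = 1 := by simp [j]
  have hj2 : j (0 + ((Real.pi : ℂ) * Complex.I) + ((Real.pi : ℂ) * Complex.I)) = 1 := by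
    simp only [j, ContinuousMap.coe_mk]
    rw [show -(0 + ((Real.pi : ℂ) * Complex.I) + ((Real.pi : ℂ) * Complex.I)) = -(2 * Real.pi * Complex.I) by ring, Complex.exp_neg,
      Complex.exp_two_pi_mul_I, inv_one]
  obtain ⟨ε, hε, hε0⟩ := exists_flat (p := p0) fP (epU (k 0)) (j 0) (by
    rw [epU_flat.proj, ← hjk])
  have h1 := ((hε.comp j).congr hjk).unique (continuous_fU.comp k.continuous)
    (epU_flat.comp k) 0 hε0 (0 + ((Real.pi : ℂ) * Complex.I) + ((Real.pi : ℂ) * Complex.I))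
  rw [hj2, ← hj0, hε0] at h1
  have h2 := epU_flat.deck continuous_fU TC fU_TC (.refl p0) (k 0) (by
    rw [UT.act_refl]; exact h1.symm) z
  rw [h2, UT.act_refl]

lemma epV_TV_TV : epV (TV (TV zV0)) = UT.base p0 := by
  let k : C(ℂ, ZU) := ⟨fun l => ⟨(l, s0), zU0.2⟩, by fun_prop⟩
  let j : C(ℂ, ZV) := ⟨fun l => ⟨(l, Complex.cosh s0), zV0.2⟩, by fun_prop⟩
  have h1 := ((epV_flat.comp j).congr (f' := fun l => fU (k l)) (fun l => rfl)).unique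
    (continuous_fU.comp k.continuous) (epU_flat.comp k) 0 (epV_0.trans epU_0.symm) (0 + ((Real.pi : ℂ) * Complex.I) + ((Real.pi : ℂ) * Complex.I))
  have h2 : TV (TV zV0) = j (0 + ((Real.pi : ℂ) * Complex.I) + ((Real.pi : ℂ) * Complex.I)) := Subtype.ext (Prod.ext rfl (neg_neg _))
  have h3 : k (0 + ((Real.pi : ℂ) * Complex.I) + ((Real.pi : ℂ) * Complex.I)) = TC zU0 := rfl
  rw [h2, h1, h3, epU_TC, epU_0]

lemma al_sq : al * al = 1 := by
  have h := epV_TV_TV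
  rw [epV_TV, epV_TV, epV_0, UT.act_act] at h
  exact UT.act_inj (h.trans (UT.act_refl _).symm)

/-- The disc through the locus `f₂ = 0`. -/
def vD (t : ℂ) : Vec := ![-(t ^ 2 / 3360), 1, -t + (t ^ 2 / 3360) ^ 2]
lemma F2_vD (t : ℂ) : F2 (vD t) = -t := by simp [F2, vD]
lemma F3_vD (t : ℂ) : F3 (vD t) = 40 + t ^ 3 / 160 := by
  simp only [F3, F2_vD]; simp [vD]; ring
def yD (t : Metric.ball (0 : ℂ) 2) : YY := ⟨vD t, by
  rw [DD, F2_vD, F3_vD]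
  have : (-(t : ℂ)) ^ 3 + (40 + (t : ℂ) ^ 3 / 160) ^ 2 = (40 - (t : ℂ) ^ 3 / 160) ^ 2 := by ring
  rw [this]
  apply pow_ne_zero
  intro h
  have h1 : (t : ℂ) ^ 3 = 6400 := by linear_combination (-160) * h
  have h2 := congrArg norm h1
  have h3 : ‖(t : ℂ)‖ < 2 := mem_ball_zero_iff.1 t.2
  have h4 := pow_le_pow_left₀ (norm_nonneg _) h3.le 3
  rw [norm_pow] at h2
  rw [h2] at h4
  norm_num at h4⟩
def fD : C(Metric.ball (0 : ℂ) 2, XX) := ⟨fun t => QQ (yD t), by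
  refine continuous_QQ.comp (Continuous.subtype_mk ?_ _)
  unfold vD
  fun_prop⟩

lemma be_cube : be * be * be = 1 := by
  have : ContractibleSpace (Metric.ball (0 : ℂ) 2) :=
    (convex_ball (0 : ℂ) 2).contractibleSpace ⟨0, by simp⟩
  have e80 : Complex.exp (Real.log 80 : ℝ) = 80 := by
    rw [← Complex.ofReal_exp, Real.exp_log (by norm_num)]; norm_num
  let k : C(ℝ, ZU) := ⟨fun t => ⟨(t * Complex.I, (Real.log 80 : ℝ) - 3 * (t * Complex.I)), by
    simp only [ZU, Set.mem_ofPred_eq]; simp [Complex.log_re]; exact Real.log_pos (show (1 : ℝ) < 80 by norm_num)⟩, by fun_prop⟩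
  let j : C(ℝ, Metric.ball (0 : ℂ) 2) := ⟨fun t => ⟨Complex.exp (2 * (t * Complex.I)), by
    rw [show (2 : ℂ) * (t * Complex.I) = ((2 * t : ℝ) : ℂ) * Complex.I by push_cast; ring,
      mem_ball_zero_iff, Complex.norm_exp_ofReal_mul_I]
    norm_num⟩, by fun_prop⟩
  have hjk : ∀ t, fD (j t) = fU (k t) := by
    intro t
    obtain ⟨h, e⟩ := fE_of (fD (j t)) ((mem_Yne_QQ _).2 (by simp [yD, vD])) (t * Complex.I)
      (Complex.cosh ((Real.log 80 : ℝ) - 3 * (t * Complex.I))) (by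
        change uu (QQ (yD _)) = _
        rw [uu_QQ]; simp only [yD, F2_vD]; simp [vD, j]) (by
        change ww (QQ (yD _)) = _
        rw [ww_QQ]; simp only [yD, F3_vD]
        simp only [vD, j, ContinuousMap.coe_mk, Matrix.cons_val, one_pow, div_one]
        rw [Complex.cosh, neg_sub, Complex.exp_sub, Complex.exp_sub, e80]
        have e2 : Complex.exp (2 * (t * Complex.I)) ^ 3 = Complex.exp (3 * (t * Complex.I)) ^ 2 := by
          rw [← Complex.exp_nat_mul, ← Complex.exp_nat_mul]; push_cast; ring_nf
        rw [e2]
        field_simp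
        ring)
    rw [← e]
    rfl
  have hj2 : j Real.pi = j 0 := by
    apply Subtype.ext
    simp only [j, ContinuousMap.coe_mk]
    rw [← mul_assoc, Complex.exp_two_pi_mul_I]; simp
  obtain ⟨ε, hε, hε0⟩ := exists_flat (p := p0) fD (epU (k 0)) (j 0) (by
    rw [epU_flat.proj, ← hjk])
  have h1 := ((hε.comp j).congr hjk).unique (continuous_fU.comp k.continuous)
    (epU_flat.comp k) 0 hε0 Real.pi
  rw [hj2, hε0] at h1
  have h2 : TB (TB (TB (k 0))) = TC (k Real.pi) := by
    apply Subtype.ext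
    simp only [TB, TC, k, ContinuousMap.coe_mk]
    refine Prod.ext ?_ ?_
    · simp
    · simp; ring
  have h3 : epU (TB (TB (TB (k 0)))) = epU (k 0) := by
    rw [h2, epU_TC, ← h1]
  rw [epU_TB, epU_TB, epU_TB, UT.act_act, UT.act_act] at h3
  have h4 := UT.act_inj (h3.trans (UT.act_refl _).symm)
  rw [mul_assoc]
  exact h4

end C315

namespace C315
open unitInterval


lemma int_orbit {S : Type} (R : S → S → Prop) (hrefl : ∀ z, R z z)
    (hsymm : ∀ {z w}, R z w → R w z) (htrans : ∀ {z w u}, R z w → R w u → R z u) (T : S → S)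
    (hT : ∀ z, R z (T z)) (Sh : ℤ → S → S → Prop) (h0 : ∀ z z', Sh 0 z z' → z = z')
    (h1 : ∀ n z z', Sh (n + 1) z z' → Sh n (T z) z')
    (h2 : ∀ n z z', Sh n z z' → Sh (n + 1) z (T z')) (n : ℤ) :
    ∀ z z', Sh n z z' → R z z' := by
  induction n using Int.induction_on with
  | zero => intro z z' h; rw [h0 _ _ h]; exact hrefl _
  | succ n ih => intro z z' h; exact htrans (hT z) (ih _ _ (h1 _ _ _ h))
  | pred n ih =>
    intro z z' h
    have := h2 _ _ _ h
    rw [sub_add_cancel] at this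
    exact htrans (ih _ _ this) (hsymm (hT z'))

def Gam : Subgroup (FundamentalGroup XX p0) := Subgroup.closure {al, be}
lemma al_mem : al ∈ Gam := Subgroup.subset_closure (by simp)
lemma be_mem : be ∈ Gam := Subgroup.subset_closure (by simp)

lemma compat_VV (z z' : ZV) (h : fV z = fV z') : Rel Gam (epV z) (epV z') := by
  obtain ⟨⟨n, hn⟩, _⟩ := fE_fiber h
  refine int_orbit (fun z z' => Rel Gam (epV z) (epV z')) (fun _ => Rel.refl _) Rel.symm
    Rel.trans TV (fun z => .of_act al_mem (epV_TV z))
    (fun n z z' => z'.1.1 = z.1.1 + n * ((Real.pi : ℂ) * Complex.I) ∧ fV z = fV z') ?_ ?_ ?_ n z z' ⟨hn, h⟩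
  · rintro z z' ⟨e1, e2⟩
    have h3 := (fE_fiber e2).2
    simp only [eV] at h3
    simp at e1
    rw [e1] at h3
    exact Subtype.ext (Prod.ext e1.symm (mul_left_cancel₀ (Complex.exp_ne_zero _) h3))
  · rintro n z z' ⟨e1, e2⟩
    refine ⟨?_, (fV_TV z).trans e2⟩
    rw [e1]; simp [TV]; ring
  · rintro n z z' ⟨e1, e2⟩
    refine ⟨?_, e2.trans (fV_TV z').symm⟩
    simp [TV, e1]; ring

lemma compat_UU (z z' : ZU) (h : fU z = fU z') : Rel Gam (epU z) (epU z') := by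
  obtain ⟨a, b, h1, h2⟩ := fU_fiber h
  let w : ZU := ⟨(z.1.1 + a * ((Real.pi : ℂ) * Complex.I), z.1.2 - a * ((Real.pi : ℂ) * Complex.I)), by
    have := z.2
    simpa [ZU] using this⟩
  have r1 : Rel Gam (epU z) (epU w) := by
    refine int_orbit (fun z z' => Rel Gam (epU z) (epU z')) (fun _ => Rel.refl _) Rel.symm
      Rel.trans TB (fun z => .of_act be_mem (epU_TB z))
      (fun n z z' => z'.1.1 = z.1.1 + n * ((Real.pi : ℂ) * Complex.I) ∧ z'.1.2 = z.1.2 - n * ((Real.pi : ℂ) * Complex.I)) ?_ ?_ ?_ a z w ⟨rfl, rfl⟩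
    · rintro z z' ⟨e1, e2⟩
      simp at e1 e2
      exact Subtype.ext (Prod.ext e1.symm e2.symm)
    · rintro n z z' ⟨e1, e2⟩
      rw [e1, e2]; simp [TB]; constructor <;> ring
    · rintro n z z' ⟨e1, e2⟩
      simp [TB, e1, e2]; constructor <;> ring
  have r2 : Rel Gam (epU w) (epU z') := by
    refine int_orbit (fun z z' => Rel Gam (epU z) (epU z')) (fun _ => Rel.refl _) Rel.symm
      Rel.trans TC (fun z => by rw [epU_TC]; exact Rel.refl _)
      (fun n z z' => z'.1.1 = z.1.1 + n * (2 * Real.pi * Complex.I) ∧ z'.1.2 = z.1.2)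
      ?_ ?_ ?_ b w z' ⟨h1, h2⟩
    · rintro z z' ⟨e1, e2⟩
      simp at e1 e2
      exact Subtype.ext (Prod.ext e1.symm e2.symm)
    · rintro n z z' ⟨e1, e2⟩
      rw [e1, e2]; simp [TC]; ring
    · rintro n z z' ⟨e1, e2⟩
      simp [TC, e1, e2]; ring
  exact r1.trans r2

def ZW : Set (ℂ × ℂ) := {z | 0 < z.2.im}
instance : ContractibleSpace ZW := by
  refine Convex.contractibleSpace ?_ ⟨(0, Complex.I), by simp [ZW]⟩
  have : ZW = Set.univ ×ˢ {z : ℂ | 0 < z.im} := by ext z; simp [ZW]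
  rw [this]
  exact convex_univ.prod (convex_halfSpace_im_gt _)

def kV : C(ZW, ZV) := ⟨fun z => ⟨z.1, by
  have h : 0 < z.1.2.im := z.2
  simp only [ZV, Set.mem_ofPred_eq, Complex.mem_slitPlane_iff]
  by_cases hr : z.1.2.re = 0
  · left; simp [pow_two, hr]; positivity
  · right; simp [pow_two]; intro h2
    have : z.1.2.re * z.1.2.im = 0 := by linarith
    rcases mul_eq_zero.1 this with h | h
    · exact hr h
    · linarith⟩, by fun_prop⟩

lemma sinh_one_pos : 0 < Real.sinh 1 := Real.sinh_pos_iff.2 one_pos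

lemma compat_UV (z : ZU) (z' : ZV) (h : fU z = fV z') : Rel Gam (epU z) (epV z') := by
  have key : ∀ (z' : ZV), 0 < z'.1.2.im → ∀ z, fU z = fV z' → Rel Gam (epU z) (epV z') := by
    intro z' hz' z h
    refine transfer epU_flat compat_UU (continuous_fV.comp kV.continuous) (epV_flat.comp kV)
      ?_ zU0 ⟨(0, Complex.cosh s0), ?_⟩ ?_ ⟨z'.1, hz'⟩ z h
    · intro w
      obtain ⟨u, hu⟩ := exists_fU (eV (kV w)) (by
        intro r hr e
        have h1 : 0 < w.1.2.im := w.2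
        have h2 : w.1.2 = r := e
        rw [h2] at h1
        simp at h1)
      change LocSec fU (fE (eV (kV w)))
      rw [← hu]
      exact locsec_fU u
    · simp only [ZW, Set.mem_ofPred_eq]
      rw [cosh_s0, Complex.im_ofReal_mul, Complex.I_im, mul_one]; exact sinh_one_pos
    · rw [epU_0]
      change Rel Gam _ (epV zV0)
      rw [epV_0]
      exact Rel.refl _
  rcases lt_trichotomy z'.1.2.im 0 with h1 | h1 | h1
  · refine (key (TV z') ?_ z (h.trans (fV_TV z').symm)).trans
      (Rel.symm (.of_act al_mem (epV_TV z')))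
    simp [TV, h1]
  · exfalso
    obtain ⟨⟨n, hn⟩, h2⟩ := fE_fiber h
    simp only [eU, eV] at hn h2
    have h4 : Complex.exp (3 * z'.1.1) = Complex.exp (3 * z.1.1) * (-1) ^ n := by
      rw [hn, mul_add, Complex.exp_add, show (3 : ℂ) * (n * (Real.pi * Complex.I))
        = ((3 * n : ℤ) : ℂ) * (Real.pi * Complex.I) by push_cast; ring, exp_int_pi, zpow_mul]
      norm_num
    rw [h4, mul_assoc] at h2
    have h5 := mul_left_cancel₀ (Complex.exp_ne_zero _) h2
    have h6 : z'.1.2 = (z'.1.2.re : ℂ) := Complex.ext rfl (by simpa using h1)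
    have h7 : 1 - z'.1.2 ^ 2 ∈ Complex.slitPlane := z'.2
    set r := z'.1.2.re
    rw [h6] at h5 h7
    have h8 : (1 : ℂ) - (r : ℂ) ^ 2 = ((1 - r ^ 2 : ℝ) : ℂ) := by push_cast; ring
    rw [h8, Complex.ofReal_mem_slitPlane] at h7
    have h9 : |r| ≤ 1 := by
      rw [← sq_le_one_iff_abs_le_one]; linarith
    refine cosh_not_real z.2 ((-1) ^ n * r) ?_ ?_
    · rw [abs_mul, abs_zpow]; simpa using h9
    · rw [h5]; push_cast; ring
  · exact key z' h1 z h

def a0 : KK := ⟨(-3, 0), by simp [KK]; norm_num⟩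

lemma exists_eB {f : BB → XX} (hf : Continuous f) (hfU : ∀ b : BB, b.1.1 ≠ 0 → ∃ z, fU z = f b) :
    ∃ ε : BB → UT p0, IsFlat f ε ∧ ∀ (b : BB) (z : ZU), b.1.1 ≠ 0 → fU z = f b →
      Rel Gam (epU z) (ε b) := by
  obtain ⟨z0, hz0⟩ := hfU _ (kB_ne a0)
  obtain ⟨ε, hε, h0⟩ := exists_flat (p := p0) ⟨f, hf⟩ (epU z0) (kB a0)
    (by rw [epU_flat.proj, hz0]; rfl)
  refine ⟨ε, hε, ?_⟩
  intro b z hb hz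
  obtain ⟨a, rfl⟩ := kB_surj b hb
  refine transfer epU_flat compat_UU (hf.comp kB.continuous) (hε.comp kB)
      ?_ z0 a0 (by rw [h0]; exact Rel.refl _) a z hz
  intro a
  obtain ⟨u, hu⟩ := hfU _ (kB_ne a)
  rw [Function.comp_apply, ← hu]
  exact locsec_fU u

lemma pieces_cover (x : XX) : (∃ z, fV z = x) ∨ (∃ z, fU z = x) ∨ LocSec fN x ∨ LocSec fM x := by
  by_cases hx : x ∈ Yne
  · by_cases hu : uu x = 0
    · exact Or.inr (Or.inr (Or.inr (locsec_fM x hx hu)))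
    · obtain ⟨z, rfl⟩ := exists_fE x hx hu
      rcases exists_UV z with h | h
      · exact Or.inl h
      · exact Or.inr (Or.inl h)
  · exact Or.inr (Or.inr (Or.inl (locsec_fN x hx)))

theorem Gam_top : Gam = ⊤ := by
  rw [Subgroup.eq_top_iff']
  intro g
  obtain ⟨eN, hN, cN⟩ := exists_eB continuous_fN fN_fU
  obtain ⟨eM, hM, cM⟩ := exists_eB continuous_fM fM_fU
  have neV : ∀ z, uu (fV z) ≠ 0 := fun z => by
    rw [fV, uu_fE]; exact neg_ne_zero.2 (Complex.exp_ne_zero _)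
  have neU : ∀ z, uu (fU z) ≠ 0 := fun z => by
    rw [fU, uu_fE]; exact neg_ne_zero.2 (Complex.exp_ne_zero _)
  have yV : ∀ z, fV z ∈ Yne := fun z => fE_mem _
  have yU : ∀ z, fU z ∈ Yne := fun z => fE_mem _
  have NN : ∀ b b', fN b = fN b' → Rel Gam (eN b) (eN b') := fun b b' h => by
    rw [fN_inj h]; exact Rel.refl _
  have MM : ∀ b b', fM b = fM b' → Rel Gam (eM b) (eM b') := fun b b' h => by
    rw [fM_inj h]; exact Rel.refl _
  have UN : ∀ z b, fU z = fN b → Rel Gam (epU z) (eN b) := fun z b h =>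
    cN b z ((fN_mem_Yne b).1 (h ▸ yU z)) h
  have UM : ∀ z b, fU z = fM b → Rel Gam (epU z) (eM b) := fun z b h =>
    cM b z (by rw [← fM_uu, ← h]; exact neU z) h
  have VN : ∀ z b, fV z = fN b → Rel Gam (epV z) (eN b) := fun z b h => by
    obtain ⟨w, hw⟩ := fN_fU b ((fN_mem_Yne b).1 (h ▸ yV z))
    exact (compat_UV w z (hw.trans h.symm)).symm.trans (UN w b hw)
  have VM : ∀ z b, fV z = fM b → Rel Gam (epV z) (eM b) := fun z b h => by
    obtain ⟨w, hw⟩ := fM_fU b (by rw [← fM_uu, ← h]; exact neV z)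
    exact (compat_UV w z (hw.trans h.symm)).symm.trans (UM w b hw)
  have NM : ∀ b' b, fN b' = fM b → Rel Gam (eN b') (eM b) := fun b' b h => by
    obtain ⟨w, hw⟩ := fN_fU b' ((fN_mem_Yne b').1 (by
      rw [h, fM, mem_Yne_QQ]; simp [yM, vecM]))
    exact (UN w b' hw).symm.trans (UM w b (hw.trans h))
  refine generation (Γ := Gam) (fun t => (∀ z, fV z = t.1 → Rel Gam (epV z) t) ∧
    (∀ z, fU z = t.1 → Rel Gam (epU z) t) ∧ (∀ z, fN z = t.1 → Rel Gam (eN z) t) ∧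
    (∀ z, fM z = t.1 → Rel Gam (eM z) t)) ?_ ?_ ?_ g
  · rw [← epV_0, epV_flat.proj]
    exact ⟨fun z h => compat_VV _ _ h, fun z h => compat_UV _ _ h,
      fun z h => (VN _ _ h.symm).symm, fun z h => (VM _ _ h.symm).symm⟩
  · rintro t ht ⟨h, -⟩
    rw [← epV_0]
    exact h zV0 (by rw [ht]; rfl)
  · intro x
    rcases pieces_cover x with ⟨z, rfl⟩ | ⟨z, rfl⟩ | h | h
    · refine ⟨ZV, _, fV, epV, epV_flat, locsec_fV z, fun t ht => ht.1, ?_⟩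
      intro z t ht
      have e := ht.fst
      rw [epV_flat.proj] at e
      rw [e]
      exact ⟨fun z' h => (compat_VV _ _ h).trans ht, fun z' h => (compat_UV _ _ h).trans ht,
        fun z' h => (VN _ _ h.symm).symm.trans ht, fun z' h => (VM _ _ h.symm).symm.trans ht⟩
    · refine ⟨ZU, _, fU, epU, epU_flat, locsec_fU z, fun t ht => ht.2.1, ?_⟩
      intro z t ht
      have e := ht.fst
      rw [epU_flat.proj] at e
      rw [e]
      exact ⟨fun z' h => (compat_UV _ _ h.symm).symm.trans ht, fun z' h => (compat_UU _ _ h).trans ht,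
        fun z' h => (UN _ _ h.symm).symm.trans ht, fun z' h => (UM _ _ h.symm).symm.trans ht⟩
    · refine ⟨BB, _, fN, eN, hN, h, fun t ht => ht.2.2.1, ?_⟩
      intro z t ht
      have e := ht.fst
      rw [hN.proj] at e
      rw [e]
      exact ⟨fun z' h => (VN _ _ h).trans ht, fun z' h => (UN _ _ h).trans ht,
        fun z' h => (NN _ _ h).trans ht, fun z' h => (NM _ _ h.symm).symm.trans ht⟩
    · refine ⟨BB, _, fM, eM, hM, h, fun t ht => ht.2.2.2, ?_⟩
      intro z t ht
      have e := ht.fst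
      rw [hM.proj] at e
      rw [e]
      exact ⟨fun z' h => (VM _ _ h).trans ht, fun z' h => (UM _ _ h).trans ht,
        fun z' h => (NM _ _ h).trans ht, fun z' h => (MM _ _ h).trans ht⟩

lemma joined_p0 (x : XX) : Joined p0 x := by
  have jV : ∀ z, Joined p0 (fV z) := fun z =>
    ⟨(PathConnectedSpace.somePath zV0 z).map continuous_fV⟩
  have jU : ∀ z, Joined p0 (fU z) := fun z =>
    ⟨(PathConnectedSpace.somePath zU0 z).map continuous_fU⟩
  have jB : ∀ {f : BB → XX} (_ : Continuous f) (_ : ∀ b : BB, b.1.1 ≠ 0 → ∃ z, fU z = f b) (b : BB),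
      Joined p0 (f b) := by
    intro f hf hfU b
    obtain ⟨z0, hz0⟩ := hfU _ (kB_ne a0)
    have h1 := jU z0
    rw [hz0] at h1
    exact h1.trans ⟨(PathConnectedSpace.somePath (kB a0) b).map hf⟩
  rcases pieces_cover x with ⟨z, rfl⟩ | ⟨z, rfl⟩ | h | h
  · exact jV z
  · exact jU z
  · obtain ⟨O, sg, _, hx, _, hs⟩ := h
    have := hs ⟨x, hx⟩
    rw [← show fN _ = x from this]
    exact jB continuous_fN fN_fU _
  · obtain ⟨O, sg, _, hx, _, hs⟩ := h
    have := hs ⟨x, hx⟩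
    rw [← show fM _ = x from this]
    exact jB continuous_fM fM_fU _

end C315

namespace C315
open unitInterval
open scoped Topology

section cocycle
variable {X G ι : Type} [TopologicalSpace X] [Group G]

/-- The principal bundle with discrete fibre given by a locally constant cocycle. -/
def coreOf (hG : TopologicalSpace G) (hd : DiscreteTopology G) (O : ι → Set X)
    (hO : ∀ i, IsOpen (O i)) (ia : X → ι)
    (hia : ∀ x, x ∈ O (ia x)) (k : ι → X → G)
    (hk : ∀ i j x, x ∈ O i → x ∈ O j →
      ∀ᶠ y in 𝓝 x, k j y * (k i y)⁻¹ = k j x * (k i x)⁻¹) : FiberBundleCore ι X G where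
  baseSet := O
  isOpen_baseSet := hO
  indexAt := ia
  mem_baseSet_at := hia
  coordChange i j x v := k j x * (k i x)⁻¹ * v
  coordChange_self i x hx v := by simp
  continuousOn_coordChange i j := by
    rintro ⟨x, v⟩ ⟨⟨hi, hj⟩, -⟩
    refine ContinuousAt.continuousWithinAt ?_
    refine ContinuousAt.mul (f := fun p : X × G => k j p.1 * (k i p.1)⁻¹) ?_ continuous_snd.continuousAt
    refine continuousAt_const (y := k j x * (k i x)⁻¹) |>.congr ?_
    have := (continuous_fst (X := X) (Y := G)).continuousAt (x := (x, v)) |>.eventually (hk i j x hi hj)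
    filter_upwards [this] with p hp using hp.symm
  coordChange_comp i j l x hx v := by group

theorem cov_of_cocycle (O : ι → Set X) (hO : ∀ i, IsOpen (O i)) (hcov : ∀ x, ∃ i, x ∈ O i)
    (k : ι → X → G) (hk : ∀ i j x, x ∈ O i → x ∈ O j →
      ∀ᶠ y in 𝓝 x, k j y * (k i y)⁻¹ = k j x * (k i x)⁻¹) :
    ∃ (E : Type) (_ : TopologicalSpace E) (π : E → X) (ab : E → G), IsCoveringMap π ∧
      (∀ e e', π e = π e' → ab e = ab e' → e = e') ∧
      ∀ (Z : Type) (_ : TopologicalSpace Z) (f : Z → X) (_ : Continuous f) (c : Z → G),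
        (∀ z, ∃ i, f z ∈ O i ∧ ∀ᶠ z' in 𝓝 z, k i (f z') * c z' = k i (f z) * c z) →
        ∃ s : Z → E, Continuous s ∧ (∀ z, π (s z) = f z) ∧ ∀ z, ab (s z) = c z := by
  choose ia hia using hcov
  let hG : TopologicalSpace G := ⊥
  have hd : DiscreteTopology G := ⟨rfl⟩
  let B := coreOf hG hd O hO ia hia k hk
  refine ⟨B.TotalSpace, inferInstance, B.proj, fun e => (k (ia e.1) e.1)⁻¹ * (show G from e.2), ?_, ?_, ?_⟩
  · exact FiberBundle.isCoveringMap (F := G) (E := B.Fiber)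
  · rintro ⟨x, g⟩ ⟨x', g'⟩ h1 h2
    obtain rfl : x = x' := h1
    have := mul_left_cancel h2
    exact congrArg (Bundle.TotalSpace.mk x) this
  · intro Z _ f hf c hc
    refine ⟨fun z => ⟨f z, k (ia (f z)) (f z) * c z⟩, ?_, fun z => rfl, fun z => ?_⟩
    · rw [continuous_iff_continuousAt]
      intro z
      obtain ⟨i, hi, h⟩ := hc z
      refine (B.localTriv i).continuousAt_of_comp_left hf.continuousAt hi ?_
      refine ContinuousAt.prodMk (f := f) hf.continuousAt ?_
      refine (continuousAt_const (y := k i (f z) * c z)).congr ?_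
      filter_upwards [h] with z' hz'
      change _ = k i (f z') * (k (ia (f z')) (f z'))⁻¹ * (k (ia (f z')) (f z') * c z')
      rw [← hz']; group
    · exact inv_mul_cancel_left _ _
end cocycle

section roots
variable {G : Type} [Group G]

/-- Evaluation of a root of unity in a group. -/
def ev (d : ℕ) (g : G) (z : ℂ) : G :=
  open Classical in
  if h : ∃ k : ℕ, Complex.exp (2 * Real.pi * Complex.I / d) ^ k = z then g ^ h.choose else 1

variable {d : ℕ} {g : G}

lemma ev_pow (hd : d ≠ 0) (hg : g ^ d = 1) (k : ℕ) :
    ev d g (Complex.exp (2 * Real.pi * Complex.I / d) ^ k) = g ^ k := by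
  have h : ∃ j : ℕ, Complex.exp (2 * Real.pi * Complex.I / d) ^ j
      = Complex.exp (2 * Real.pi * Complex.I / d) ^ k := ⟨k, rfl⟩
  rw [ev, dif_pos h]
  have hp := Complex.isPrimitiveRoot_exp d hd
  have h1 := h.choose_spec
  have h2 : h.choose ≡ k [MOD d] := by
    have := (hp.isOfFinOrder hd).pow_eq_pow_iff_modEq.1 h1
    rwa [← hp.eq_orderOf] at this
  refine pow_eq_pow_iff_modEq.2 (h2.of_dvd (orderOf_dvd_of_pow_eq_one hg))

lemma ev_mul (hd : d ≠ 0) (hg : g ^ d = 1) {z w : ℂ} (hz : z ^ d = 1) (hw : w ^ d = 1) :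
    ev d g (z * w) = ev d g z * ev d g w := by
  have : NeZero d := ⟨hd⟩
  obtain ⟨i, -, rfl⟩ := (Complex.isPrimitiveRoot_exp d hd).eq_pow_of_pow_eq_one hz
  obtain ⟨j, -, rfl⟩ := (Complex.isPrimitiveRoot_exp d hd).eq_pow_of_pow_eq_one hw
  rw [← pow_add, ev_pow hd hg, ev_pow hd hg, ev_pow hd hg, pow_add]

lemma ev_gen (hd : d ≠ 0) (hg : g ^ d = 1) : ev d g (Complex.exp (2 * Real.pi * Complex.I / d)) = g := by
  simpa using ev_pow hd hg 1

lemma ev_commute (hd : d ≠ 0) (hg : g ^ d = 1) {z : ℂ} (hz : z ^ d = 1) :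
    Commute g (ev d g z) := by
  have : NeZero d := ⟨hd⟩
  obtain ⟨i, -, rfl⟩ := (Complex.isPrimitiveRoot_exp d hd).eq_pow_of_pow_eq_one hz
  rw [ev_pow hd hg]
  exact (Commute.refl g).pow_right i

lemma roots_locconst (hd : d ≠ 0) {Z : Type} [TopologicalSpace Z] {ζ : Z → ℂ} {z : Z}
    (hc : ContinuousAt ζ z) (h : ∀ᶠ y in 𝓝 z, ζ y ^ d = 1) : ∀ᶠ y in 𝓝 z, ζ y = ζ z := by
  have hfin : ({w : ℂ | w ^ d = 1} \ {ζ z}).Finite := by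
    refine Set.Finite.subset ((Polynomial.nthRoots d (1 : ℂ)).toFinset.finite_toSet) ?_
    intro w hw
    simpa [Polynomial.mem_nthRoots (Nat.pos_of_ne_zero hd)] using hw.1
  have hn : ({w : ℂ | w ^ d = 1} \ {ζ z})ᶜ ∈ 𝓝 (ζ z) :=
    hfin.isClosed.isOpen_compl.mem_nhds (by simp)
  filter_upwards [hc hn, h] with y h1 h2
  by_contra h3
  exact h1 ⟨h2, h3⟩

/-- The root-of-unity part. -/
def rho (d : ℕ) (c : ℂ) : ℂ := c / (c ^ d) ^ (1 / d : ℂ)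

lemma cpow_root (hd : d ≠ 0) (c : ℂ) : (c ^ (1 / d : ℂ)) ^ d = c := by
  rw [one_div]; exact Complex.cpow_nat_inv_pow _ hd

lemma rho_pow (hd : d ≠ 0) {c : ℂ} (hc : c ≠ 0) : rho d c ^ d = 1 := by
  rw [rho, div_pow, cpow_root hd, div_self (pow_ne_zero _ hc)]

lemma rho_mul {ζ c : ℂ} (hζ : ζ ^ d = 1) : rho d (ζ * c) = ζ * rho d c := by
  rw [rho, rho, mul_pow, hζ, one_mul, mul_div_assoc]

lemma rho_cont (hd : d ≠ 0) {c : ℂ} (hc : c ^ d ∈ Complex.slitPlane) : ContinuousAt (rho d) c := by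
  have hc0 : c ≠ 0 := by
    rintro rfl
    rw [zero_pow hd] at hc
    exact Complex.slitPlane_ne_zero hc rfl
  refine continuousAt_id.div ((continuousAt_id.pow d).cpow continuousAt_const hc) ?_
  intro h
  have := cpow_root hd (c ^ d)
  change (c ^ d) ^ (1 / d : ℂ) = 0 at h
  rw [h, zero_pow hd] at this
  exact pow_ne_zero d hc0 this.symm
end roots

end C315

namespace C315
open unitInterval
open scoped Topology

/-- The invariant used for the normalization in the two charts. -/
def FF : Bool → Vec → ℂ
  | false => F2
  | true => F3
/-- Its degree. -/
def dd : Bool → ℕ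
  | false => 2
  | true => 3
lemma dd_ne (t : Bool) : dd t ≠ 0 := by cases t <;> simp [dd]
lemma FF_smul (t : Bool) (c : ℂ) (v : Vec) : FF t (c • v) = c ^ dd t * FF t v := by
  cases t
  · exact F2_smul c v
  · exact F3_smul c v
lemma continuous_FF (t : Bool) : Continuous (FF t) := by
  cases t
  · exact continuous_F2
  · exact continuous_F3

open Classical in
/-- An equivariant nonvanishing function on normalized vectors. -/
def cc : Bool → Vec → ℂ
  | false => fun v => if F3 v ≠ 0 then F3 v else v 1
  | true => fun v => if F2 v ≠ 0 then (F2 v)⁻¹ else v 1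

lemma root_ne {d : ℕ} (hd : d ≠ 0) {ζ : ℂ} (h : ζ ^ d = 1) : ζ ≠ 0 := by
  rintro rfl; simp [hd] at h

lemma cc_smul (t : Bool) {ζ : ℂ} (hζ : ζ ^ dd t = 1) (v : Vec) : cc t (ζ • v) = ζ * cc t v := by
  have h0 : ζ ≠ 0 := root_ne (dd_ne t) hζ
  cases t
  · simp only [dd] at hζ
    simp only [cc, F3_smul]
    by_cases h : F3 v = 0
    · simp [h]
    · have h1 : ζ ^ 3 * F3 v ≠ 0 := mul_ne_zero (pow_ne_zero _ h0) h
      rw [if_pos h1, if_pos h]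
      linear_combination ζ * F3 v * hζ
  · simp only [dd] at hζ
    simp only [cc, F2_smul]
    by_cases h : F2 v = 0
    · simp [h]
    · have h1 : ζ ^ 2 * F2 v ≠ 0 := mul_ne_zero (pow_ne_zero _ h0) h
      rw [if_pos h1, if_pos h]
      field_simp
      exact hζ.symm

lemma cc_ne (t : Bool) {v : Vec} (hv : FF t v = 1) : cc t v ≠ 0 := by
  cases t
  · simp only [FF] at hv
    simp only [cc]
    split_ifs with h
    · exact h
    · intro hy
      have h3 : F3 v = 0 := not_not.1 h
      rw [F3, hv, hy] at h3
      have hx : v 0 = 0 := by linear_combination h3 / 21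
      rw [F2, hy, hx] at hv
      norm_num at hv
  · simp only [FF] at hv
    simp only [cc]
    split_ifs with h
    · exact inv_ne_zero h
    · intro hy
      rw [F3, not_not.1 h, hy] at hv
      norm_num at hv

/-- The degree-zero invariant. -/
def qq : Bool → Vec → ℂ
  | false => fun v => F3 v ^ 2 / F2 v ^ 3
  | true => fun v => F2 v ^ 3 / F3 v ^ 2
lemma qq_smul (t : Bool) {c : ℂ} (hc : c ≠ 0) (v : Vec) : qq t (c • v) = qq t v := by
  cases t
  · simp only [qq, F2_smul, F3_smul]
    rw [mul_pow, mul_pow, ← pow_mul, ← pow_mul, mul_div_mul_left _ _ (pow_ne_zero _ hc)]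
  · simp only [qq, F2_smul, F3_smul]
    rw [mul_pow, mul_pow, ← pow_mul, ← pow_mul, mul_div_mul_left _ _ (pow_ne_zero _ hc)]

lemma slit_iff {z : ℂ} : z ∉ Complex.slitPlane ↔ ∃ r : ℝ, r ≤ 0 ∧ z = r := by
  rw [Complex.mem_slitPlane_iff]
  push Not
  constructor
  · rintro ⟨h1, h2⟩
    exact ⟨z.re, h1, Complex.ext rfl (by simpa using h2)⟩
  · rintro ⟨r, hr, rfl⟩
    simpa using hr

lemma inv_slit {z : ℂ} (hz : z ∈ Complex.slitPlane) : z⁻¹ ∈ Complex.slitPlane := by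
  by_contra h
  obtain ⟨r, hr, e⟩ := slit_iff.1 h
  refine slit_iff.2 ⟨r⁻¹, inv_nonpos.2 hr, ?_⟩ hz
  rw [← inv_inv z, e]; simp

/-- The two open sets. -/
def Dom (t : Bool) : Set XX := {x | FF t (rp x).1 ≠ 0 ∧ 1 + qq t (rp x).1 ∈ Complex.slitPlane}

lemma Dom_cover (x : XX) : ∃ t, x ∈ Dom t := by
  have hD : F2 (rp x).1 ^ 3 + F3 (rp x).1 ^ 2 ≠ 0 := (rp x).2
  by_cases h2 : F2 (rp x).1 = 0
  · refine ⟨true, ?_, ?_⟩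
    · intro h3
      simp only [FF] at h3
      rw [h2, h3] at hD; norm_num at hD
    · simp [qq, h2]
  by_cases hs : 1 + qq false (rp x).1 ∈ Complex.slitPlane
  · exact ⟨false, h2, hs⟩
  refine ⟨true, ?_, ?_⟩
  · intro h3
    apply hs
    simp only [FF] at h3
    simp [qq, h3]
  · obtain ⟨r, hr, e⟩ := slit_iff.1 hs
    have e1 : F3 (rp x).1 ^ 2 = ((r - 1 : ℝ) : ℂ) * F2 (rp x).1 ^ 3 := by
      simp only [qq] at e
      field_simp at e
      push_cast
      linear_combination e
    have hr0 : r ≠ 0 := by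
      rintro rfl
      apply hD; rw [e1]; push_cast; ring
    have hr1 : r < 0 := lt_of_le_of_ne hr hr0
    have : 1 + qq true (rp x).1 = ((1 + 1 / (r - 1) : ℝ) : ℂ) := by
      simp only [qq]
      rw [e1]
      have : (r : ℂ) - 1 ≠ 0 := by
        exact_mod_cast (show r - 1 ≠ 0 by linarith)
      push_cast
      field_simp
    rw [this, Complex.ofReal_mem_slitPlane]
    have : 1 + 1 / (r - 1) = r / (r - 1) := by
      have : r - 1 ≠ 0 := by linarith
      field_simp; ring
    rw [this]
    exact div_pos_of_neg_of_neg hr1 (by linarith)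

lemma Dom_inter (x : XX) (h0 : x ∈ Dom false) (h1 : x ∈ Dom true) (t : Bool) :
    qq t (rp x).1 ∈ Complex.slitPlane := by
  have hinv : qq true (rp x).1 = (qq false (rp x).1)⁻¹ := by simp [qq]
  have key : qq false (rp x).1 ∈ Complex.slitPlane := by
    by_contra h
    obtain ⟨r, hr, e⟩ := slit_iff.1 h
    have hne : qq false (rp x).1 ≠ 0 := by
      have h2 : F2 (rp x).1 ≠ 0 := h0.1
      have h3 : F3 (rp x).1 ≠ 0 := h1.1
      simp [qq, h2, h3]
    have hr0 : r < 0 := by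
      refine lt_of_le_of_ne hr ?_
      rintro rfl
      exact hne (by rw [e]; simp)
    have a0 := h0.2
    have a1 := h1.2
    rw [hinv, e] at a1
    rw [e] at a0
    rw [show (1 : ℂ) + r = ((1 + r : ℝ) : ℂ) by push_cast; rfl, Complex.ofReal_mem_slitPlane] at a0
    rw [show (1 : ℂ) + (r : ℂ)⁻¹ = ((1 + r⁻¹ : ℝ) : ℂ) by push_cast; rfl, Complex.ofReal_mem_slitPlane] at a1
    have : r * r⁻¹ = 1 := mul_inv_cancel₀ hr0.ne
    nlinarith
  cases t
  · exact key
  · rw [hinv]; exact inv_slit key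

lemma cc_cont (t : Bool) {v : Vec} (hv : FF t v = 1) (hq : qq t v ∈ Complex.slitPlane) :
    ContinuousAt (cc t) v ∧ cc t v ^ dd t ∈ Complex.slitPlane := by
  have hq0 := Complex.slitPlane_ne_zero hq
  cases t
  · simp only [FF] at hv
    have h3 : F3 v ≠ 0 := by
      intro h; apply hq0; simp [qq, h]
    constructor
    · refine continuous_F3.continuousAt.congr ?_
      filter_upwards [continuous_F3.continuousAt.eventually_ne h3] with w hw
      simp [cc, hw]
    · simp only [qq, hv] at hq
      simpa [cc, h3, dd] using hq
  · simp only [FF] at hv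
    have h2 : F2 v ≠ 0 := by
      intro h; apply hq0; simp [qq, h]
    constructor
    · refine (continuous_F2.continuousAt.inv₀ h2).congr ?_
      filter_upwards [continuous_F2.continuousAt.eventually_ne h2] with w hw
      simp [cc, hw]
    · simp only [qq, hv] at hq
      rw [one_pow, div_one] at hq
      simp only [cc, if_pos h2, dd, inv_pow]
      exact inv_slit hq

section kap
variable {G : Type} [Group G] (gg : Bool → G)

def kap (t : Bool) (v : Vec) : G := ev (dd t) (gg t) (rho (dd t) (cc t v))

variable {gg}

lemma kap_smul (hgg : ∀ t, gg t ^ dd t = 1) (t : Bool) {ζ : ℂ} (hζ : ζ ^ dd t = 1) {v : Vec} (hv : FF t v = 1) :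
    kap gg t (ζ • v) = ev (dd t) (gg t) ζ * kap gg t v := by
  rw [kap, cc_smul t hζ, rho_mul hζ, ev_mul (dd_ne t) (hgg t) hζ (rho_pow (dd_ne t) (cc_ne t hv)), kap]

lemma kap_comm (hgg : ∀ t, gg t ^ dd t = 1) (t : Bool) {v : Vec} (hv : FF t v = 1) : Commute (gg t) (kap gg t v) :=
  ev_commute (dd_ne t) (hgg t) (rho_pow (dd_ne t) (cc_ne t hv))

lemma kap_W (t : Bool) {Z : Type} [TopologicalSpace Z] {n : Z → Vec} {z : Z}
    (hn : ContinuousAt n z) (h1 : ∀ᶠ y in 𝓝 z, FF t (n y) = 1)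
    (hq : qq t (n z) ∈ Complex.slitPlane) : ∀ᶠ y in 𝓝 z, kap gg t (n y) = kap gg t (n z) := by
  obtain ⟨hc, hs⟩ := cc_cont t h1.self_of_nhds hq
  have h2 : ContinuousAt (fun y => rho (dd t) (cc t (n y))) z :=
    ContinuousAt.comp (f := fun y => cc t (n y)) (rho_cont (dd_ne t) hs) (ContinuousAt.comp (f := n) hc hn)
  have := roots_locconst (dd_ne t) h2 (by
    filter_upwards [h1] with y hy using rho_pow (dd_ne t) (cc_ne t hy))
  filter_upwards [this] with y hy
  rw [kap, hy, kap]

lemma kap_ratio (hgg : ∀ t, gg t ^ dd t = 1) (t : Bool) {Z : Type} [TopologicalSpace Z] {n n' : Z → Vec} {z : Z}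
    (hn : ContinuousAt n z) (hn' : ContinuousAt n' z)
    (h : ∀ᶠ y in 𝓝 z, FF t (n y) = 1 ∧ FF t (n' y) = 1 ∧ ∃ c : ℂ, n' y = c • n y) :
    ∀ᶠ y in 𝓝 z, kap gg t (n' y) * (kap gg t (n y))⁻¹ = kap gg t (n' z) * (kap gg t (n z))⁻¹ := by
  have hz := h.self_of_nhds
  obtain ⟨i, hi⟩ : ∃ i, n z i ≠ 0 := by
    by_contra! h0
    have : n z = (0 : ℂ) • n z := by ext i; simp [h0 i]
    have h1 := hz.1
    rw [this, FF_smul, zero_pow (dd_ne t), zero_mul] at h1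
    norm_num at h1
  have ci : ContinuousAt (fun y => n y i) z := (continuous_apply (A := fun _ : Fin 3 => ℂ) i).continuousAt.comp hn
  have ci' : ContinuousAt (fun y => n' y i) z := (continuous_apply (A := fun _ : Fin 3 => ℂ) i).continuousAt.comp hn'
  have hcζ : ContinuousAt (fun y => n' y i / n y i) z := ci'.div ci hi
  have hev : ∀ᶠ y in 𝓝 z, FF t (n y) = 1 ∧ (n' y i / n y i) ^ dd t = 1 ∧
      n' y = (n' y i / n y i) • n y := by
    filter_upwards [h, ci.eventually_ne hi] with y hy hyi
    obtain ⟨h1, h2, c, hc⟩ := hy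
    have : n' y i / n y i = c := by
      rw [hc]; simp [hyi]
    rw [this]
    refine ⟨h1, ?_, hc⟩
    rw [hc, FF_smul, h1, mul_one] at h2
    exact h2
  have hr := roots_locconst (dd_ne t) hcζ (hev.mono fun y hy => hy.2.1)
  have form : ∀ y, (FF t (n y) = 1 ∧ (n' y i / n y i) ^ dd t = 1 ∧
      n' y = (n' y i / n y i) • n y) → kap gg t (n' y) * (kap gg t (n y))⁻¹ =
        ev (dd t) (gg t) (n' y i / n y i) := by
    intro y hy
    obtain ⟨h1, h2, h3⟩ := hy
    generalize n' y i / n y i = ζ at h2 h3 ⊢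
    rw [h3, kap_smul hgg t h2 h1, mul_inv_cancel_right]
  filter_upwards [hev, hr] with y h1 h2
  rw [form y h1, form z hev.self_of_nhds, h2]
end kap

end C315

namespace C315
open unitInterval
open scoped Topology

/-- A chart: a normalized local section of the cone. -/
structure Chart where
  t : Bool
  O : Set XX
  n : XX → Vec
  isOpen : IsOpen O
  sub : O ⊆ Dom t
  cont : ContinuousOn n O
  one : ∀ x ∈ O, FF t (n x) = 1
  lift : ∀ x ∈ O, ∃ c : ℂ, c ≠ 0 ∧ n x = c • (rp x).1

lemma qq_cont (t : Bool) {v : Vec} (hv : FF t v ≠ 0) : ContinuousAt (qq t) v := by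
  have h2 := continuous_F2.continuousAt (x := v)
  have h3 := continuous_F3.continuousAt (x := v)
  cases t
  · exact (h3.pow 2).div (h2.pow 3) (pow_ne_zero _ hv)
  · exact (h2.pow 3).div (h3.pow 2) (pow_ne_zero _ hv)

def nrm (k : Fin 3) (v : Vec) : Vec := (v k)⁻¹ • v
lemma nrm_smul (k : Fin 3) {c : ℂ} (hc : c ≠ 0) (v : Vec) : nrm k (c • v) = nrm k v := by
  simp only [nrm, Pi.smul_apply, smul_eq_mul, smul_smul]
  congr 1
  field_simp
lemma nrm_cont (k : Fin 3) {v : Vec} (hv : v k ≠ 0) : ContinuousAt (nrm k) v :=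
  ((continuous_apply (A := fun _ : Fin 3 => ℂ) k).continuousAt.inv₀ hv).smul continuousAt_id

def chq (t : Bool) (k : Fin 3) (c : ℂ) (v : Vec) : ℂ := FF t (nrm k v) / c ^ dd t
def chn (t : Bool) (k : Fin 3) (c : ℂ) (v : Vec) : Vec :=
  (c * chq t k c v ^ (1 / dd t : ℂ))⁻¹ • nrm k v
def chP (t : Bool) (k : Fin 3) (c : ℂ) (v : Vec) : Prop :=
  FF t v ≠ 0 ∧ 1 + qq t v ∈ Complex.slitPlane ∧ v k ≠ 0 ∧ chq t k c v ∈ Complex.slitPlane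

lemma chq_cont (t : Bool) (k : Fin 3) (c : ℂ) {v : Vec} (hv : v k ≠ 0) :
    ContinuousAt (chq t k c) v :=
  ((continuous_FF t).continuousAt.comp (nrm_cont k hv)).div_const _

lemma chq_root_ne {t : Bool} {k : Fin 3} {c : ℂ} {v : Vec} (h : chq t k c v ∈ Complex.slitPlane) :
    chq t k c v ^ (1 / dd t : ℂ) ≠ 0 := by
  intro h0
  have := cpow_root (dd_ne t) (chq t k c v)
  rw [h0, zero_pow (dd_ne t)] at this
  exact Complex.slitPlane_ne_zero h this.symm

lemma chP_eventually {t : Bool} {k : Fin 3} {c : ℂ} {v : Vec} (h : chP t k c v) :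
    ∀ᶠ w in 𝓝 v, chP t k c w := by
  obtain ⟨h1, h2, h3, h4⟩ := h
  have e2 : ∀ᶠ w in 𝓝 v, 1 + qq t w ∈ Complex.slitPlane :=
    (continuousAt_const.add (qq_cont t h1)).eventually (Complex.isOpen_slitPlane.mem_nhds h2)
  have e4 : ∀ᶠ w in 𝓝 v, chq t k c w ∈ Complex.slitPlane :=
    (chq_cont t k c h3).eventually (Complex.isOpen_slitPlane.mem_nhds h4)
  filter_upwards [(continuous_FF t).continuousAt.eventually_ne h1, e2,
    (continuous_apply (A := fun _ : Fin 3 => ℂ) k).continuousAt.eventually_ne h3, e4] with w a b c d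
  exact ⟨a, b, c, d⟩

def mkChart (t : Bool) (k : Fin 3) (c : ℂ) (hc : c ≠ 0) : Chart where
  t := t
  O := {x | chP t k c (rp x).1}
  n x := chn t k c (rp x).1
  isOpen := by
    refine isOpen_deg0 (fun a v ha h => ?_) ?_
    · obtain ⟨h1, h2, h3, h4⟩ := h
      refine ⟨?_, ?_, ?_, ?_⟩
      · rw [FF_smul]; exact mul_ne_zero (pow_ne_zero _ ha) h1
      · rwa [qq_smul t ha]
      · simp [ha, h3]
      · rwa [chq, nrm_smul k ha]
    · rw [isOpen_iff_mem_nhds]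
      intro v hv
      exact continuous_subtype_val.continuousAt.eventually (chP_eventually hv)
  sub x hx := ⟨hx.1, hx.2.1⟩
  cont := by
    rintro x ⟨-, -, h3, h4⟩
    refine ContinuousAt.continuousWithinAt (continuousAt_deg0 (f := chn t k c) ?_ x ?_)
    · intro a v ha
      rw [chn, chn, chq, nrm_smul k ha, chq]
    · have h5 : ContinuousAt (fun v => c * chq t k c v ^ (1 / dd t : ℂ)) (rp x).1 :=
        ContinuousAt.mul continuousAt_const ((chq_cont t k c h3).cpow continuousAt_const h4)
      exact ContinuousAt.smul (h5.inv₀ (mul_ne_zero hc (chq_root_ne h4))) (nrm_cont k h3)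
  one x hx := by
    obtain ⟨-, -, h3, h4⟩ := hx
    have hne := Complex.slitPlane_ne_zero h4
    rw [chn, FF_smul, inv_pow, mul_pow, cpow_root (dd_ne t)]
    have : FF t (nrm k (rp x).1) = c ^ dd t * chq t k c (rp x).1 := by
      rw [chq, mul_div_cancel₀ _ (pow_ne_zero _ hc)]
    rw [this]
    exact inv_mul_cancel₀ (mul_ne_zero (pow_ne_zero _ hc) hne)
  lift x hx := by
    obtain ⟨-, -, h3, h4⟩ := hx
    refine ⟨_, ?_, by rw [chn, nrm, smul_smul]⟩
    exact mul_ne_zero (inv_ne_zero (mul_ne_zero hc (chq_root_ne h4))) (inv_ne_zero h3)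

lemma exists_chart (t : Bool) (x : XX) (hx : x ∈ Dom t) : ∃ i : Chart, i.t = t ∧ x ∈ i.O := by
  obtain ⟨k, hk⟩ : ∃ k, (rp x).1 k ≠ 0 := by
    by_contra! h
    exact ne_zero_of_DD (rp x).2 (funext h)
  have hF : FF t (nrm k (rp x).1) ≠ 0 := by
    rw [nrm, FF_smul]
    exact mul_ne_zero (pow_ne_zero _ (inv_ne_zero hk)) hx.1
  have hr := cpow_root (dd_ne t) (FF t (nrm k (rp x).1))
  have hc : FF t (nrm k (rp x).1) ^ (1 / dd t : ℂ) ≠ 0 := by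
    intro h0
    rw [h0, zero_pow (dd_ne t)] at hr
    exact hF hr.symm
  refine ⟨mkChart t k _ hc, rfl, hx.1, hx.2, hk, ?_⟩
  rw [chq, hr, div_self hF]
  exact Complex.one_mem_slitPlane

section
variable {G : Type} [Group G] {gg : Bool → G}

lemma chart_compat (hgg : ∀ t, gg t ^ dd t = 1) (i j : Chart) (x : XX) (hi : x ∈ i.O) (hj : x ∈ j.O) :
    ∀ᶠ y in 𝓝 x, kap gg j.t (j.n y) * (kap gg i.t (i.n y))⁻¹ =
      kap gg j.t (j.n x) * (kap gg i.t (i.n x))⁻¹ := by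
  have ni := i.isOpen.mem_nhds hi
  have nj := j.isOpen.mem_nhds hj
  have ci := i.cont.continuousAt ni
  have cj := j.cont.continuousAt nj
  by_cases h : j.t = i.t
  · rw [h]
    refine kap_ratio hgg i.t ci cj ?_
    filter_upwards [ni, nj] with y hyi hyj
    obtain ⟨c, hc, e⟩ := i.lift y hyi
    obtain ⟨c', hc', e'⟩ := j.lift y hyj
    refine ⟨i.one y hyi, h ▸ j.one y hyj, c' * c⁻¹, ?_⟩
    rw [e, e', smul_smul, inv_mul_cancel_right₀ hc]
  · have hD : ∀ t, x ∈ Dom t := by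
      have h1 := i.sub hi
      have h2 := j.sub hj
      intro t
      by_cases e : t = i.t
      · rw [e]; exact h1
      · have : t = j.t := by
          revert h e; cases t <;> cases j.t <;> cases i.t <;> simp
        rw [this]; exact h2
    have key : ∀ i : Chart, x ∈ i.O → ∀ᶠ y in 𝓝 x, kap gg i.t (i.n y) = kap gg i.t (i.n x) := by
      intro i hi
      have ni := i.isOpen.mem_nhds hi
      refine kap_W i.t (i.cont.continuousAt ni) (Filter.mem_of_superset ni i.one) ?_
      obtain ⟨c, hc, e⟩ := i.lift x hi
      rw [e, qq_smul _ hc]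
      exact Dom_inter x (hD _) (hD _) _
    filter_upwards [key i hi, key j hj] with y h1 h2
    rw [h1, h2]

lemma lift_cond (hgg : ∀ t, gg t ^ dd t = 1) (t : Bool) {Z : Type} [TopologicalSpace Z]
    {f : Z → XX} (hf : Continuous f) {n : Z → Vec} (hn : Continuous n) (hD : ∀ z, f z ∈ Dom t)
    (h1 : ∀ z, FF t (n z) = 1) (hl : ∀ z, ∃ c : ℂ, c ≠ 0 ∧ n z = c • (rp (f z)).1) (h : G) (z : Z) :
    ∃ i : Chart, f z ∈ i.O ∧ ∀ᶠ z' in 𝓝 z,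
      kap gg i.t (i.n (f z')) * ((kap gg t (n z'))⁻¹ * h) =
      kap gg i.t (i.n (f z)) * ((kap gg t (n z))⁻¹ * h) := by
  obtain ⟨i, rfl, hi⟩ := exists_chart t (f z) (hD z)
  refine ⟨i, hi, ?_⟩
  have ni := i.isOpen.mem_nhds hi
  have := kap_ratio hgg i.t hn.continuousAt ((i.cont.continuousAt ni).comp hf.continuousAt) (by
    filter_upwards [hf.continuousAt ni] with y hy
    obtain ⟨c, hc, e⟩ := i.lift (f y) hy
    obtain ⟨c', hc', e'⟩ := hl y
    refine ⟨h1 y, i.one _ hy, c * c'⁻¹, ?_⟩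
    rw [Function.comp_apply, e, e', smul_smul, inv_mul_cancel_right₀ hc'])
  filter_upwards [this] with y hy
  rw [← mul_assoc, ← mul_assoc]
  exact congrArg (· * h) hy
end

/-! normalized lifts over the two pieces -/

lemma QQ_lift (v : YY) (c : ℂ) (hc : c ≠ 0) : ∃ c' : ℂ, c' ≠ 0 ∧ c • v.1 = c' • (rp (QQ v)).1 := by
  obtain ⟨a, ha, h⟩ := rp_QQ v
  refine ⟨c * a⁻¹, mul_ne_zero hc (inv_ne_zero ha), ?_⟩
  rw [h, smul_smul, inv_mul_cancel_right₀ ha]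

lemma fE_lift (z : ZE) (c : ℂ) (hc : c ≠ 0) :
    ∃ c' : ℂ, c' ≠ 0 ∧ c • vecA (aE z).1.1 (aE z).1.2 = c' • (rp (fE z)).1 :=
  QQ_lift ⟨vecA (aE z).1.1 (aE z).1.2, _⟩ c hc

lemma FF_fE (t : Bool) (z : ZE) : FF t (vecA (aE z).1.1 (aE z).1.2) =
    cond t (Complex.exp (3 * z.1.1) * z.1.2) (-Complex.exp (2 * z.1.1)) := by
  cases t
  · exact F2_vecA _ _
  · exact F3_vecA _ (aE z).2.1

lemma fE_Dom (t : Bool) (z : ZE) (h : FF t (vecA (aE z).1.1 (aE z).1.2) ≠ 0)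
    (hq : 1 + qq t (vecA (aE z).1.1 (aE z).1.2) ∈ Complex.slitPlane) : fE z ∈ Dom t := by
  obtain ⟨c, hc, e⟩ := fE_lift z 1 one_ne_zero
  rw [one_smul] at e
  rw [e, FF_smul] at h
  rw [e, qq_smul t hc] at hq
  exact ⟨right_ne_zero_of_mul h, hq⟩

lemma continuous_vec : Continuous fun z : ZE => vecA (aE z).1.1 (aE z).1.2 := by
  have h1 : Continuous (fun z : ZE => ((aE z).1.2 - 40) / (21 * (aE z).1.1)) := by
    refine Continuous.div (by unfold aE; fun_prop) (by unfold aE; fun_prop)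
      fun z => mul_ne_zero (by norm_num) (aE z).2.1
  unfold vecA
  refine continuous_pi fun i => ?_
  fin_cases i
  · exact h1
  · exact continuous_const
  · exact Continuous.add (by unfold aE; fun_prop) (h1.pow 2)

lemma exp_rel (l : ℂ) : Complex.exp (3 * l) ^ 2 = Complex.exp (2 * l) ^ 3 := by
  rw [← Complex.exp_nat_mul, ← Complex.exp_nat_mul]; push_cast; ring_nf

lemma qq_fE (z : ZE) : qq false (vecA (aE z).1.1 (aE z).1.2) = - z.1.2 ^ 2 := by
  have h2 := FF_fE false z
  have h3 := FF_fE true z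
  simp only [FF, cond] at h2 h3
  simp only [qq, h2, h3]
  rw [mul_pow, exp_rel, neg_pow]
  have := Complex.exp_ne_zero (2 * z.1.1)
  field_simp

def nV (z : ZV) : Vec :=
  (Complex.I * Complex.exp z.1.1)⁻¹ • vecA (aE (eV z)).1.1 (aE (eV z)).1.2

lemma continuous_nV : Continuous nV := by
  have h1 : Continuous eV := by unfold eV; fun_prop
  have h2 : Continuous fun z : ZV => Complex.I * Complex.exp z.1.1 := by fun_prop
  refine Continuous.smul (h2.inv₀ fun z => ?_) (continuous_vec.comp h1)
  exact mul_ne_zero Complex.I_ne_zero (Complex.exp_ne_zero _)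

lemma FF_nV (z : ZV) : FF false (nV z) = 1 := by
  rw [nV, FF_smul, FF_fE]
  simp only [cond, dd]
  rw [inv_pow, mul_pow, Complex.I_sq, ← Complex.exp_nat_mul]
  push_cast
  have := Complex.exp_ne_zero (2 * z.1.1)
  simp only [eV]
  field_simp

lemma lift_nV (z : ZV) : ∃ c : ℂ, c ≠ 0 ∧ nV z = c • (rp (fV z)).1 :=
  fE_lift _ _ (inv_ne_zero (mul_ne_zero Complex.I_ne_zero (Complex.exp_ne_zero _)))

lemma fV_Dom (z : ZV) : fV z ∈ Dom false := by
  refine fE_Dom _ _ ?_ ?_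
  · rw [FF_fE]; exact neg_ne_zero.2 (Complex.exp_ne_zero _)
  · rw [qq_fE]
    rw [← sub_eq_add_neg]
    exact z.2

lemma aE_TV (z : ZV) : aE (eV (TV z)) = aE (eV z) := by
  apply Subtype.ext
  refine Prod.ext (congrArg Neg.neg (exp2_add _)) ?_
  change Complex.exp (3 * (z.1.1 + (Real.pi : ℂ) * Complex.I)) * (- z.1.2) = Complex.exp (3 * z.1.1) * z.1.2
  rw [exp3_add]; ring

lemma nV_TV (z : ZV) : nV (TV z) = (-1 : ℂ) • nV z := by
  rw [nV, aE_TV, nV, smul_smul]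
  congr 1
  change (Complex.I * Complex.exp (z.1.1 + (Real.pi : ℂ) * Complex.I))⁻¹ = _
  rw [Complex.exp_add, Complex.exp_pi_mul_I]
  field_simp

/-- A cube root of `cosh`. -/
def Rt (s : ℂ) : ℂ := Complex.exp (s / 3) * ((1 + Complex.exp (-2 * s)) / 2) ^ (1 / (3 : ℕ) : ℂ)

lemma Rt_pow (s : ℂ) : Rt s ^ 3 = Complex.cosh s := by
  rw [Rt, mul_pow, cpow_root three_ne_zero, ← Complex.exp_nat_mul, Complex.cosh]
  push_cast
  rw [mul_div_cancel₀ _ three_ne_zero, show -2 * s = -s - s by ring, Complex.exp_sub]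
  have := Complex.exp_ne_zero s
  field_simp

lemma Rt_slit {s : ℂ} (hs : 0 < s.re) : (1 + Complex.exp (-2 * s)) / 2 ∈ Complex.slitPlane := by
  refine Or.inl ?_
  have h1 : ‖Complex.exp (-2 * s)‖ < 1 := by
    rw [Complex.norm_exp]
    simpa using hs
  have h2 := (abs_le.1 (Complex.abs_re_le_norm (Complex.exp (-2 * s)))).1
  have : ((1 + Complex.exp (-2 * s)) / 2).re = (1 + (Complex.exp (-2 * s)).re) / 2 := by
    rw [show (1 + Complex.exp (-2 * s)) / 2 = (1 + Complex.exp (-2 * s)) / ((2 : ℝ) : ℂ) by norm_num,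
      Complex.div_ofReal_re]
    simp
  rw [this]
  linarith

lemma Rt_ne {s : ℂ} (hs : 0 < s.re) : Rt s ≠ 0 := by
  intro h
  have h1 := Rt_pow s
  rw [h] at h1
  exact cosh_not_real hs 0 (by simp) (by rw [← h1]; simp)

def nU (z : ZU) : Vec :=
  (Complex.exp z.1.1 * Rt z.1.2)⁻¹ • vecA (aE (eU z)).1.1 (aE (eU z)).1.2

lemma continuous_nU : Continuous nU := by
  have h1 : Continuous eU := by unfold eU; fun_prop
  have h2 : Continuous fun z : ZU => Complex.exp z.1.1 := by fun_prop
  have h3 : Continuous fun z : ZU => Complex.exp (z.1.2 / 3) := by fun_prop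
  have h4 : Continuous fun z : ZU => (1 + Complex.exp (-2 * z.1.2)) / 2 := by fun_prop
  have h5 : Continuous fun z : ZU => Rt z.1.2 :=
    h3.mul (h4.cpow continuous_const fun z => Rt_slit z.2)
  refine Continuous.smul ((h2.mul h5).inv₀ fun z => ?_) (continuous_vec.comp h1)
  exact mul_ne_zero (Complex.exp_ne_zero _) (Rt_ne z.2)

lemma FF_nU (z : ZU) : FF true (nU z) = 1 := by
  rw [nU, FF_smul, FF_fE]
  simp only [cond, dd]
  have h := Rt_pow z.1.2
  have hne := pow_ne_zero 3 (Rt_ne z.2)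
  rw [inv_pow, mul_pow, ← Complex.exp_nat_mul]
  push_cast
  simp only [eU]
  rw [← h]
  exact inv_mul_cancel₀ (mul_ne_zero (Complex.exp_ne_zero _) hne)

lemma lift_nU (z : ZU) : ∃ c : ℂ, c ≠ 0 ∧ nU z = c • (rp (fU z)).1 :=
  fE_lift _ _ (inv_ne_zero (mul_ne_zero (Complex.exp_ne_zero _) (Rt_ne z.2)))

lemma fU_Dom (z : ZU) : fU z ∈ Dom true := by
  have hc : Complex.cosh z.1.2 ≠ 0 := fun h => cosh_not_real z.2 0 (by simp) (by rw [h]; simp)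
  refine fE_Dom _ _ ?_ ?_
  · rw [FF_fE]; exact mul_ne_zero (Complex.exp_ne_zero _) hc
  · have hinv : qq true (vecA (aE (eU z)).1.1 (aE (eU z)).1.2) =
        (qq false (vecA (aE (eU z)).1.1 (aE (eU z)).1.2))⁻¹ := by simp [qq]
    rw [hinv, qq_fE]
    simp only [eU]
    by_contra h
    obtain ⟨r, hr, e⟩ := slit_iff.1 h
    have h1 : 0 < 1 - r := by linarith
    have e2 : Complex.cosh z.1.2 ^ 2 = ((Real.sqrt (1 - r)⁻¹ : ℝ) : ℂ) ^ 2 := by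
      rw [← Complex.ofReal_pow, Real.sq_sqrt (by positivity)]
      push_cast
      have : (1 : ℂ) - r ≠ 0 := by exact_mod_cast h1.ne'
      field_simp at e ⊢
      linear_combination e
    have hle : |Real.sqrt (1 - r)⁻¹| ≤ 1 := by
      rw [abs_of_nonneg (Real.sqrt_nonneg _), Real.sqrt_le_one]
      exact inv_le_one_of_one_le₀ (by linarith)
    rcases sq_eq_sq_iff_eq_or_eq_neg.1 e2 with h | h
    · exact cosh_not_real z.2 _ hle h
    · exact cosh_not_real z.2 (-Real.sqrt (1 - r)⁻¹) (by rwa [abs_neg]) (by rw [h]; simp)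

lemma aE_TB (z : ZU) : aE (eU (TB z)) = aE (eU z) := by
  apply Subtype.ext
  refine Prod.ext (congrArg Neg.neg (exp2_add _)) ?_
  change Complex.exp (3 * (z.1.1 + (Real.pi : ℂ) * Complex.I)) *
    Complex.cosh (z.1.2 - (Real.pi : ℂ) * Complex.I) = Complex.exp (3 * z.1.1) * Complex.cosh z.1.2
  rw [exp3_add, cosh_sub_pi]; ring

lemma nU_TB (z : ZU) : nU z = Complex.exp (2 * Real.pi * Complex.I / (3 : ℕ)) • nU (TB z) := by
  rw [nU, nU, aE_TB, smul_smul]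
  congr 1
  change _ = _ * (Complex.exp (z.1.1 + (Real.pi : ℂ) * Complex.I) *
    (Complex.exp ((z.1.2 - (Real.pi : ℂ) * Complex.I) / 3) *
    ((1 + Complex.exp (-2 * (z.1.2 - (Real.pi : ℂ) * Complex.I))) / 2) ^ (1 / (3 : ℕ) : ℂ)))⁻¹
  have e1 : Complex.exp (-2 * (z.1.2 - (Real.pi : ℂ) * Complex.I)) = Complex.exp (-2 * z.1.2) := by
    rw [show -2 * (z.1.2 - (Real.pi : ℂ) * Complex.I) = -2 * z.1.2 + 2 * Real.pi * Complex.I by ring,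
      Complex.exp_add, Complex.exp_two_pi_mul_I, mul_one]
  have e2 : Complex.exp (z.1.1 + (Real.pi : ℂ) * Complex.I) *
      Complex.exp ((z.1.2 - (Real.pi : ℂ) * Complex.I) / 3) =
      Complex.exp (2 * Real.pi * Complex.I / (3 : ℕ)) * (Complex.exp z.1.1 * Complex.exp (z.1.2 / 3)) := by
    rw [← Complex.exp_add, ← Complex.exp_add, ← Complex.exp_add]
    congr 1
    push_cast
    ring
  rw [e1, ← mul_assoc, e2, Rt, mul_assoc (Complex.exp (2 * Real.pi * Complex.I / (3 : ℕ))),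
    mul_inv (Complex.exp (2 * Real.pi * Complex.I / (3 : ℕ))),
    mul_inv_cancel_left₀ (Complex.exp_ne_zero _), mul_assoc]

end C315

namespace C315
open unitInterval
open scoped Topology

theorem exists_action {G : Type} [Group G] {gg : Bool → G} (hgg : ∀ t, gg t ^ dd t = 1) :
    ∃ (E : Type) (A : FundamentalGroup XX p0 → E → E) (ab : E → G), Nonempty E ∧
      (∀ e, A 1 e = e) ∧ (∀ p q e, A (p * q) e = A p (A q e)) ∧
      (∀ e, ab (A al e) = gg false * ab e) ∧ (∀ e, ab (A be e) = gg true * ab e) := by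
  obtain ⟨E, hE, π, ab, cov, inj, sec⟩ := cov_of_cocycle (fun i : Chart => i.O) (fun i => i.isOpen)
    (fun x => by
      obtain ⟨t, ht⟩ := Dom_cover x
      obtain ⟨i, -, hi⟩ := exists_chart t x ht
      exact ⟨i, hi⟩) (fun i x => kap gg i.t (i.n x)) (chart_compat hgg)
  have secV : ∀ h : G, ∃ s : ZV → E, Continuous s ∧ (∀ z, π (s z) = fV z) ∧
      ∀ z, ab (s z) = (kap gg false (nV z))⁻¹ * h := fun h =>
    sec ZV _ fV continuous_fV _
      (lift_cond hgg false continuous_fV continuous_nV fV_Dom FF_nV lift_nV h)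
  have secU : ∀ h : G, ∃ s : ZU → E, Continuous s ∧ (∀ z, π (s z) = fU z) ∧
      ∀ z, ab (s z) = (kap gg true (nU z))⁻¹ * h := fun h =>
    sec ZU _ fU continuous_fU _
      (lift_cond hgg true continuous_fU continuous_nU fU_Dom FF_nU lift_nU h)
  refine ⟨π ⁻¹' {p0}, fun g => cov.monodromy g, fun e => ab e.1, ?_, ?_, ?_, ?_, ?_⟩
  · obtain ⟨s, -, h, -⟩ := secV 1
    exact ⟨⟨s zV0, h zV0⟩⟩
  · intro e
    exact congrFun cov.monodromy_refl e
  · intro p q e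
    exact cov.monodromy_trans_apply q p e
  · intro e
    obtain ⟨s, hs, hπ, hab⟩ := secV (kap gg false (nV zV0) * ab e.1)
    have h0 : s zV0 = e.1 := by
      refine inj _ _ ((hπ zV0).trans e.2.symm) ?_
      rw [hab, inv_mul_cancel_left]
    have h1 := monodromy_flat cov continuous_fV epV_flat s hs hπ zV0 (TV zV0) epV_0 al
      (by rw [epV_TV, epV_0]) e h0
    change ab (cov.monodromy al e).1 = _
    have hm : ((-1 : ℂ)) ^ dd false = 1 := by simp [dd]
    have hev : ev (dd false) (gg false) (-1) = gg false := by
      have h := ev_gen (dd_ne false) (hgg false)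
      have : Complex.exp (2 * Real.pi * Complex.I / (dd false : ℕ)) = -1 := by
        rw [← Complex.exp_pi_mul_I]; congr 1; simp only [dd]; push_cast; ring
      rwa [this] at h
    rw [h1, hab, nV_TV, kap_smul hgg false hm (FF_nV _), hev]
    have hc := kap_comm hgg false (FF_nV zV0)
    have hsq : gg false * gg false = 1 := by
      have := hgg false
      rwa [dd, pow_two] at this
    have hinv : (gg false)⁻¹ = gg false := inv_eq_of_mul_eq_one_left hsq
    rw [hc.eq, mul_inv_rev, hinv, mul_assoc, inv_mul_cancel_left]
  · intro e
    obtain ⟨s, hs, hπ, hab⟩ := secU (kap gg true (nU zU0) * ab e.1)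
    have h0 : s zU0 = e.1 := by
      refine inj _ _ ((hπ zU0).trans e.2.symm) ?_
      rw [hab, inv_mul_cancel_left]
    have h1 := monodromy_flat cov continuous_fU epU_flat s hs hπ zU0 (TB zU0) epU_0 be
      (by rw [epU_TB, epU_0]) e h0
    change ab (cov.monodromy be e).1 = _
    have hm : Complex.exp (2 * Real.pi * Complex.I / (3 : ℕ)) ^ dd true = 1 :=
      (Complex.isPrimitiveRoot_exp 3 (by norm_num)).pow_eq_one
    have hev : ev (dd true) (gg true) (Complex.exp (2 * Real.pi * Complex.I / (3 : ℕ))) = gg true :=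
      ev_gen (dd_ne true) (hgg true)
    have hk := kap_smul hgg true hm (FF_nU (TB zU0))
    rw [← nU_TB, hev] at hk
    have hc := kap_comm hgg true (FF_nU (TB zU0))
    rw [h1, hab, hk, hc.eq.symm.symm, ← hc.eq, mul_assoc, ← mul_assoc (gg true), hc.eq, mul_assoc,
      inv_mul_cancel_left]

/-- The homomorphism from a cyclic group determined by an element. -/
def cyc {H : Type*} [Group H] (d : ℕ) [NeZero d] (h : H) (hd : h ^ d = 1) :
    Multiplicative (ZMod d) →* H where
  toFun x := h ^ (Multiplicative.toAdd x).val
  map_one' := by simp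
  map_mul' x y := by
    rw [toAdd_mul, ZMod.val_add, ← pow_add]
    exact (pow_eq_pow_mod _ hd).symm

lemma cyc_apply {H : Type*} [Group H] (d : ℕ) [NeZero d] (h : H) (hd : h ^ d = 1)
    (x : Multiplicative (ZMod d)) : cyc d h hd x = h ^ (Multiplicative.toAdd x).val := rfl

lemma gen_pow (d : ℕ) [NeZero d] (x : Multiplicative (ZMod d)) :
    (Multiplicative.ofAdd (1 : ZMod d)) ^ (Multiplicative.toAdd x).val = x := by
  rw [← ofAdd_nsmul]
  simp

abbrev GG : Type := Monoid.Coprod (Multiplicative (ZMod 2)) (Multiplicative (ZMod 3))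

def phi : GG →* FundamentalGroup XX p0 :=
  Monoid.Coprod.lift (cyc 2 al (by rw [pow_two, al_sq])) (cyc 3 be (by rw [pow_succ, pow_two, be_cube]))

lemma phi_surj : Function.Surjective phi := by
  rw [← MonoidHom.range_eq_top, eq_top_iff, ← Gam_top, Gam, Subgroup.closure_le]
  rintro g (rfl | rfl)
  · refine ⟨Monoid.Coprod.inl (Multiplicative.ofAdd 1), ?_⟩
    rw [phi, Monoid.Coprod.lift_apply_inl, cyc_apply]
    exact pow_one _
  · refine ⟨Monoid.Coprod.inr (Multiplicative.ofAdd 1), ?_⟩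
    rw [phi, Monoid.Coprod.lift_apply_inr, cyc_apply]
    exact pow_one _

def gens : Bool → GG
  | false => Monoid.Coprod.inl (Multiplicative.ofAdd 1)
  | true => Monoid.Coprod.inr (Multiplicative.ofAdd 1)

lemma gens_pow (t : Bool) : gens t ^ dd t = 1 := by
  cases t
  · simp only [gens, dd]
    rw [← map_pow, ← ofAdd_nsmul]
    exact map_one _
  · simp only [gens, dd]
    rw [← map_pow, ← ofAdd_nsmul]
    exact map_one _

lemma phi_inj : Function.Injective phi := by
  obtain ⟨E, A, ab, ⟨e0⟩, A1, Am, Aal, Abe⟩ := exists_action gens_pow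
  have pw : ∀ (p : FundamentalGroup XX p0) (g : GG), (∀ e, ab (A p e) = g * ab e) →
      ∀ (k : ℕ) e, ab (A (p ^ k) e) = g ^ k * ab e := by
    intro p g h k
    induction k with
    | zero => intro e; rw [pow_zero, A1, pow_zero, one_mul]
    | succ k ih => intro e; rw [pow_succ, Am, ih, h, pow_succ, mul_assoc]
  have key : ∀ x e, ab (A (phi x) e) = x * ab e := by
    intro x
    induction x using Monoid.Coprod.induction_on with
    | inl m =>
      intro e
      rw [phi, Monoid.Coprod.lift_apply_inl, cyc_apply, pw al _ Aal, gens, ← map_pow, gen_pow]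
    | inr m =>
      intro e
      rw [phi, Monoid.Coprod.lift_apply_inr, cyc_apply, pw be _ Abe, gens, ← map_pow, gen_pow]
    | mul x y hx hy =>
      intro e
      rw [map_mul, Am, hx, hy, mul_assoc]
  rw [injective_iff_map_eq_one]
  intro x hx
  have h := key x e0
  rw [hx, A1] at h
  exact (mul_eq_right.1 h.symm)

theorem main_XX (x : XX) : Nonempty (FundamentalGroup XX x ≃* GG) := by
  obtain ⟨γ⟩ := joined_p0 x
  exact ⟨(FundamentalGroup.fundamentalGroupMulEquivOfPath γ).symm.trans
    (MulEquiv.ofBijective phi ⟨phi_inj, phi_surj⟩).symm⟩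

theorem main_set (S : Set P2) (hS : S = {x : P2 | DD x.rep ≠ 0}) (x : ↥S) :
    Nonempty (FundamentalGroup ↥S x ≃* GG) := by
  subst hS
  exact main_XX x

end C315

/-- For `f₂ = yz − x²` and `f₃ = 40y³ + 21xyz − 21x³` (with `x = X 0`,
`y = X 1`, `z = X 2`), the sextic `C = V(f₂³ + f₃²)` (a maximal tame torus sextic with one
singular point of type `C_{3,15}`) satisfies `π₁(ℙ² \ C) ≅ ℤ₂ * ℤ₃`. -/
theorem stmt_12 (f₂ f₃ : MvPolynomial (Fin 3) ℂ)
    (hf₂ : f₂ = X 1 * X 2 - X 0 ^ 2)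
    (hf₃ : f₃ = C 40 * X 1 ^ 3 + C 21 * (X 0 * X 1 * X 2) - C 21 * X 0 ^ 3) :
    ∀ x : ↥(V (f₂ ^ 3 + f₃ ^ 2))ᶜ,
      Nonempty (FundamentalGroup (↥(V (f₂ ^ 3 + f₃ ^ 2))ᶜ) x ≃*
        Monoid.Coprod (Multiplicative (ZMod 2)) (Multiplicative (ZMod 3))) := by
  refine C315.main_set _ ?_
  ext p
  subst hf₂ hf₃
  simp only [V, Set.mem_compl_iff, Set.mem_ofPred_eq, C315.DD, C315.F3, C315.F2, ne_eq, map_add, map_sub,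
    map_mul, map_pow, eval_X, eval_C]
  ring_nf
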